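/- arXiv:2008.06013 — 8 statements merged into one kernel-verified Lean document; each statement's English description precedes it below -/
import Mathlib

section
/- Let d ≥ 1 and n ≥ 1 be integers and let F be a finite family of convex sets in ℝ^d. If the intersection of every subfamily of F with at most 2d members contains a 1-thick axis-parallel box with at least n lattice points, then the intersection of all members of F contains an axis-parallel box with at least n/3^(d-1) lattice points. -/
/-- The number of lattice points (points of `ℤ^d`) in the axis-parallel box
`bx(x,y) = ∏ [xᵢ, yᵢ]`, realized as `Set.Icc x y` in `Fin d → ℝ`. -/
noncomputable def latticeCount {d : ℕ} (x y : Fin d → ℝ) : ℕ :=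
  (Set.Icc x y ∩ {z : Fin d → ℝ | ∀ i, ∃ m : ℤ, z i = (m : ℝ)}).ncard

lemma latticeCount_eq_prod {d : ℕ} (x y : Fin d → ℝ) :
    latticeCount x y = ∏ i, (⌊y i⌋ + 1 - ⌈x i⌉).toNat := by
  have himage : Set.Icc x y ∩ {z : Fin d → ℝ | ∀ i, ∃ m : ℤ, z i = (m : ℝ)} =
      (fun (m : Fin d → ℤ) i => (m i : ℝ)) ''
        (Finset.Icc (fun i => ⌈x i⌉) (fun i => ⌊y i⌋) : Finset (Fin d → ℤ)) := by
    ext z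
    simp only [Set.mem_inter_iff, Set.mem_Icc, Set.mem_ofPred_eq, Set.mem_image,
      Finset.coe_Icc, Pi.le_def]
    constructor
    · rintro ⟨⟨hx, hy⟩, hz⟩
      choose m hm using hz
      refine ⟨m, ⟨fun i => ?_, fun i => ?_⟩, (funext hm).symm⟩
      · exact Int.ceil_le.2 (hm i ▸ hx i)
      · exact Int.le_floor.2 (hm i ▸ hy i)
    · rintro ⟨m, ⟨hx, hy⟩, rfl⟩
      exact ⟨⟨fun i => Int.ceil_le.1 (hx i), fun i => Int.le_floor.1 (hy i)⟩,
        fun i => ⟨m i, rfl⟩⟩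
  have hinj : Function.Injective (fun (m : Fin d → ℤ) i => (m i : ℝ)) := fun m m' h =>
    funext fun i => Int.cast_injective (congrFun h i)
  rw [latticeCount, himage, Set.ncard_image_of_injective _ hinj, Set.ncard_coe_finset,
    Pi.card_Icc]
  simp only [Int.card_Icc]

lemma Convex.Icc_combination_subset {ι : Type*} {A : Set (ι → ℝ)} (hA : Convex ℝ A)
    {x₁ y₁ x₂ y₂ : ι → ℝ} (h₁ : ∀ i, x₁ i < y₁ i) (h₂ : ∀ i, x₂ i < y₂ i)
    (hbox₁ : Set.Icc x₁ y₁ ⊆ A) (hbox₂ : Set.Icc x₂ y₂ ⊆ A) {a b : ℝ}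
    (ha : 0 ≤ a) (hb : 0 ≤ b) (hab : a + b = 1) :
    Set.Icc (a • x₁ + b • x₂) (a • y₁ + b • y₂) ⊆ A := by
  intro z hz
  have hpos : ∀ i, 0 < (a * y₁ i + b * y₂ i) - (a * x₁ i + b * x₂ i) := fun i => by
    rcases ha.eq_or_lt with rfl | ha'
    · have : b = 1 := by linarith
      subst this
      linarith [h₂ i]
    · nlinarith [mul_pos ha' (sub_pos.2 (h₁ i)), mul_nonneg hb (sub_pos.2 (h₂ i)).le]
  have hzx : ∀ i, a * x₁ i + b * x₂ i ≤ z i := fun i => by simpa using hz.1 i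
  have hzy : ∀ i, z i ≤ a * y₁ i + b * y₂ i := fun i => by simpa using hz.2 i
  set θ : ι → ℝ := fun i => (z i - (a * x₁ i + b * x₂ i)) /
    ((a * y₁ i + b * y₂ i) - (a * x₁ i + b * x₂ i)) with hθ
  have hθ0 : ∀ i, 0 ≤ θ i := fun i =>
    div_nonneg (sub_nonneg.2 (hzx i)) (hpos i).le
  have hθ1 : ∀ i, θ i ≤ 1 := fun i => by
    rw [hθ]
    dsimp only
    rw [div_le_one (hpos i)]
    linarith [hzy i]
  have hmem : ∀ {x y : ι → ℝ}, (∀ i, x i < y i) →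
      (fun i => x i + θ i * (y i - x i)) ∈ Set.Icc x y := fun {x y} hxy =>
    ⟨fun i => by nlinarith [mul_nonneg (hθ0 i) (sub_pos.2 (hxy i)).le],
      fun i => by nlinarith [mul_nonneg (sub_nonneg.2 (hθ1 i)) (sub_pos.2 (hxy i)).le]⟩
  have hz' : z = a • (fun i => x₁ i + θ i * (y₁ i - x₁ i)) +
      b • (fun i => x₂ i + θ i * (y₂ i - x₂ i)) := by
    ext i
    have := div_mul_cancel₀ (z i - (a * x₁ i + b * x₂ i)) (hpos i).ne'
    simp only [Pi.add_apply, Pi.smul_apply, smul_eq_mul]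
    change θ i * _ = _ at this
    linear_combination -this
  rw [hz']
  exact hA (hbox₁ (hmem h₁)) (hbox₂ (hmem h₂)) ha hb hab

/-- Helly's theorem for boxes whose pair of corners is taken from a convex set `S`. -/
lemma exists_Icc_subset_of_forall_card_le {k : ℕ}
    {S : Set ((Fin (k + 1) → ℝ) × (Fin (k + 1) → ℝ))} (hS : Convex ℝ S)
    (hlt : ∀ p ∈ S, ∀ i, p.1 i < p.2 i)
    (F : Finset (Set (Fin (k + 1) → ℝ))) (hconv : ∀ A ∈ F, Convex ℝ A)
    (hloc : ∀ G ⊆ F, G.card ≤ 2 * (k + 1) → ∃ p ∈ S, ∀ A ∈ G, Set.Icc p.1 p.2 ⊆ A) :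
    ∃ p ∈ S, ∀ A ∈ F, Set.Icc p.1 p.2 ⊆ A := by
  rcases F.eq_empty_or_nonempty with rfl | hF
  · exact hloc ∅ (Finset.Subset.refl _) (by simp)
  let forget : ((Fin (k + 1) → ℝ) × (Fin (k + 1) → ℝ)) →ₗ[ℝ]
      ((Fin (k + 1) → ℝ) × (Fin k → ℝ)) :=
    LinearMap.prodMap LinearMap.id (LinearMap.funLeft ℝ ℝ Fin.succ)
  let K : Set (Fin (k + 1) → ℝ) → Set ((Fin (k + 1) → ℝ) × (Fin k → ℝ)) :=
    fun A => forget '' {p | p ∈ S ∧ Set.Icc p.1 p.2 ⊆ A}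
  have hK : ∀ A ∈ F, Convex ℝ (K A) := fun A hA => by
    refine Convex.linear_image ?_ forget
    rintro p ⟨hpS, hpA⟩ q ⟨hqS, hqA⟩ a b ha hb hab
    exact ⟨hS hpS hqS ha hb hab, (hconv A hA).Icc_combination_subset (hlt p hpS)
      (hlt q hqS) hpA hqA ha hb hab⟩
  obtain ⟨ξ, hξ⟩ : (⋂ A ∈ F, K A).Nonempty := by
    refine Convex.helly_theorem' (𝕜 := ℝ) hK fun G hG hcard => ?_
    have hrank : Module.finrank ℝ ((Fin (k + 1) → ℝ) × (Fin k → ℝ)) = 2 * k + 1 := by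
      rw [Module.finrank_prod, Module.finrank_fin_fun, Module.finrank_fin_fun]
      ring
    obtain ⟨p, hpS, hp⟩ := hloc G hG (by omega)
    exact ⟨forget p, Set.mem_iInter₂.2 fun A hA => ⟨p, ⟨hpS, hp A hA⟩, rfl⟩⟩
  have hcommon : ∀ A, ∃ p, A ∈ F → p ∈ S ∧ Set.Icc p.1 p.2 ⊆ A ∧ forget p = ξ := fun A => by
    by_cases hA : A ∈ F
    · obtain ⟨p, ⟨hpS, hp⟩, hpξ⟩ := Set.mem_iInter₂.1 hξ A hA
      exact ⟨p, fun _ => ⟨hpS, hp, hpξ⟩⟩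
    · exact ⟨0, fun h => absurd h hA⟩
  choose p hp using hcommon
  obtain ⟨A₀, hA₀, hmin⟩ := F.exists_min_image (fun A => (p A).2 0) hF
  refine ⟨p A₀, (hp A₀ hA₀).1, fun A hA => Set.Subset.trans ?_ (hp A hA).2.1⟩
  have heq : forget (p A₀) = forget (p A) := (hp A₀ hA₀).2.2.trans (hp A hA).2.2.symm
  have hfst : (p A₀).1 = (p A).1 := (Prod.ext_iff.1 heq).1
  have hsnd : ∀ i : Fin k, (p A₀).2 i.succ = (p A).2 i.succ := fun i =>
    congrFun (Prod.ext_iff.1 heq).2 i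
  refine Set.Icc_subset_Icc hfst.ge fun i => ?_
  refine Fin.cases (hmin A hA) (fun j => (hsnd j).le) i

/-- The admissible edge-length vectors of a box. -/
def lengthRegion (k c : ℕ) : Set (Fin (k + 1) → ℝ) :=
  {L | (∀ i, 1 ≤ L i) ∧ 3 ^ k * (c : ℝ) < ∏ i, (L i + 1) ∧
    ∀ e, (c : ℝ) ≤ L e + ((c / 2 : ℕ) : ℝ) * ∑ j ∈ Finset.univ.erase e, (L j - 2)}

lemma lt_prod_combination {ι : Type*} [Fintype ι] {X Y : ι → ℝ} {t : ℝ}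
    (hX : ∀ i, 0 < X i) (hY : ∀ i, 0 < Y i) (htX : t < ∏ i, X i) (htY : t < ∏ i, Y i)
    {a b : ℝ} (ha : 0 ≤ a) (hb : 0 ≤ b) (hab : a + b = 1) :
    t < ∏ i, (a * X i + b * Y i) := by
  have hXpos : 0 < ∏ i, X i := Finset.prod_pos fun i _ => hX i
  have hYpos : 0 < ∏ i, Y i := Finset.prod_pos fun i _ => hY i
  have hmin : 0 < min (∏ i, X i) (∏ i, Y i) := lt_min hXpos hYpos
  calc t < min (∏ i, X i) (∏ i, Y i) := lt_min htX htY
    _ = min (∏ i, X i) (∏ i, Y i) ^ a * min (∏ i, X i) (∏ i, Y i) ^ b := by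
      rw [← Real.rpow_add hmin, hab, Real.rpow_one]
    _ ≤ (∏ i, X i) ^ a * (∏ i, Y i) ^ b :=
      mul_le_mul (Real.rpow_le_rpow hmin.le (min_le_left _ _) ha)
        (Real.rpow_le_rpow hmin.le (min_le_right _ _) hb) (by positivity) (by positivity)
    _ = ∏ i, (X i ^ a * Y i ^ b) := by
      rw [Finset.prod_mul_distrib, Real.finsetProd_rpow _ _ (fun i _ => (hX i).le),
        Real.finsetProd_rpow _ _ (fun i _ => (hY i).le)]
    _ ≤ ∏ i, (a * X i + b * Y i) :=
      Finset.prod_le_prod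
        (fun i _ => mul_nonneg (Real.rpow_nonneg (hX i).le _) (Real.rpow_nonneg (hY i).le _))
        fun i _ => Real.geom_mean_le_arith_mean2_weighted ha hb (hX i).le (hY i).le hab

lemma convex_lengthRegion (k c : ℕ) : Convex ℝ (lengthRegion k c) := by
  rintro L ⟨hL1, hLprod, hLsum⟩ M ⟨hM1, hMprod, hMsum⟩ a b ha hb hab
  refine ⟨fun i => ?_, ?_, fun e => ?_⟩
  · simp only [Pi.add_apply, Pi.smul_apply, smul_eq_mul]
    nlinarith [mul_le_mul_of_nonneg_left (hL1 i) ha, mul_le_mul_of_nonneg_left (hM1 i) hb]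
  · have h := lt_prod_combination (fun i => by linarith [hL1 i]) (fun i => by linarith [hM1 i])
      hLprod hMprod ha hb hab
    refine h.trans_eq (Finset.prod_congr rfl fun i _ => ?_)
    simp only [Pi.add_apply, Pi.smul_apply, smul_eq_mul]
    linear_combination hab
  · have hsum : ∑ j ∈ Finset.univ.erase e, ((a • L + b • M) j - 2) =
        a * ∑ j ∈ Finset.univ.erase e, (L j - 2) + b * ∑ j ∈ Finset.univ.erase e, (M j - 2) := by
      rw [Finset.mul_sum, Finset.mul_sum, ← Finset.sum_add_distrib]
      refine Finset.sum_congr rfl fun i _ => ?_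
      simp only [Pi.add_apply, Pi.smul_apply, smul_eq_mul]
      linear_combination 2 * hab
    rw [hsum]
    simp only [Pi.add_apply, Pi.smul_apply, smul_eq_mul]
    have hcomb := add_le_add (mul_le_mul_of_nonneg_left (hLsum e) ha)
      (mul_le_mul_of_nonneg_left (hMsum e) hb)
    have hc : a * (c : ℝ) + b * c = c := by linear_combination (c : ℝ) * hab
    linarith

lemma mul_four_thirds_pow_le {m : ℕ} (hm : 1 ≤ m) :
    (m : ℝ) * (4 / 3) ^ 3 ≤ 3 * (4 / 3) ^ m := by
  rcases lt_or_ge m 3 with h | h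
  · interval_cases m <;> norm_num
  · induction m, h using Nat.le_induction with
    | base => norm_num
    | succ m h ih =>
      have h3 : (3 : ℝ) ≤ m := by exact_mod_cast h
      have := ih (by omega)
      rw [pow_succ (4 / 3 : ℝ) m]
      push_cast
      linarith

lemma mul_three_halves_pow_le {m : ℕ} (hm : 1 ≤ m) :
    (m : ℝ) * (3 / 2) ^ 3 ≤ 3 * (3 / 2) ^ m := by
  rcases lt_or_ge m 3 with h | h
  · interval_cases m <;> norm_num
  · induction m, h using Nat.le_induction with
    | base => norm_num
    | succ m h ih =>
      have h3 : (3 : ℝ) ≤ m := by exact_mod_cast h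
      have := ih (by omega)
      rw [pow_succ (3 / 2 : ℝ) m]
      push_cast
      linarith

lemma prod_mul_pow_le_pow_mul {ι : Type*} (s : Finset ι) (M : ι → ℕ) {b : ℝ} (hb : 0 ≤ b)
    (h : ∀ i ∈ s, (M i : ℝ) * b ^ 3 ≤ 3 * b ^ M i) :
    (∏ i ∈ s, (M i : ℝ)) * b ^ (3 * s.card) ≤ 3 ^ s.card * b ^ ∑ i ∈ s, M i := by
  calc (∏ i ∈ s, (M i : ℝ)) * b ^ (3 * s.card) = ∏ i ∈ s, ((M i : ℝ) * b ^ 3) := by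
        rw [Finset.prod_mul_distrib, Finset.prod_const, pow_mul]
    _ ≤ ∏ i ∈ s, (3 * b ^ M i) := Finset.prod_le_prod (fun i _ => by positivity) h
    _ = 3 ^ s.card * b ^ ∑ i ∈ s, M i := by
        rw [Finset.prod_mul_distrib, Finset.prod_const, Finset.prod_pow_eq_pow_sum]

lemma lt_add_half_mul_sum {k c : ℕ} (hc : 2 ≤ c) {M : Fin (k + 1) → ℕ} (hM : ∀ i, 1 ≤ M i)
    (hprod : 3 ^ k * c < ∏ i, M i) (e : Fin (k + 1)) :
    (c : ℤ) < M e + ((c / 2 : ℕ) : ℤ) * ∑ j ∈ Finset.univ.erase e, ((M j : ℤ) - 3) := by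
  by_contra! hle
  have hcard : (Finset.univ.erase e).card = k := by simp
  have hsum : ∑ j ∈ Finset.univ.erase e, ((M j : ℤ) - 3) =
      ((∑ j ∈ Finset.univ.erase e, M j : ℕ) : ℤ) - 3 * k := by
    rw [Finset.sum_sub_distrib, Finset.sum_const, hcard]
    push_cast
    simp
    ring
  rw [hsum] at hle
  have hsplit := Finset.mul_prod_erase Finset.univ (fun i => (M i : ℝ)) (Finset.mem_univ e)
  have hfour := prod_mul_pow_le_pow_mul (Finset.univ.erase e) M (b := 4 / 3) (by norm_num)
    fun i _ => mul_four_thirds_pow_le (hM i)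
  have hthree := prod_mul_pow_le_pow_mul (Finset.univ.erase e) M (b := 3 / 2) (by norm_num)
    fun i _ => mul_three_halves_pow_le (hM i)
  rw [hcard] at hfour hthree
  have hlt : (3 : ℝ) ^ k * c < ∏ i, (M i : ℝ) := by exact_mod_cast hprod
  rw [← hsplit] at hlt
  set s := ∑ j ∈ Finset.univ.erase e, M j with hs
  set P := ∏ j ∈ Finset.univ.erase e, (M j : ℝ) with hP
  have hP0 : 0 ≤ P := Finset.prod_nonneg fun _ _ => by positivity
  have hu1 : (c : ℝ) ≤ 4 * (c / 2 : ℕ) := by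
    have : c ≤ 4 * (c / 2) := by omega
    exact_mod_cast this
  have hu2 : 2 * ((c / 2 : ℕ) : ℝ) ≤ c := by
    have : 2 * (c / 2) ≤ c := by omega
    exact_mod_cast this
  have hleR : (M e : ℝ) + ((c / 2 : ℕ) : ℝ) * ((s : ℝ) - 3 * k) ≤ c := by
    have h := Int.cast_le (R := ℝ).2 hle
    push_cast at h
    exact h
  generalize ((c / 2 : ℕ) : ℝ) = u at hu1 hu2 hleR
  have hc0 : (0 : ℝ) ≤ c := by positivity
  rcases le_total (3 * k) s with h | h
  · obtain ⟨D, hD⟩ := Nat.exists_eq_add_of_le h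
    rw [hD, pow_add, ← mul_assoc, mul_right_comm] at hfour
    have hPD : P ≤ 3 ^ k * (4 / 3) ^ D := le_of_mul_le_mul_right hfour (by positivity)
    have hbern : 1 + (D : ℝ) * (-1 / 4) ≤ (3 / 4) ^ D := by
      have := one_add_mul_le_pow (a := (-1 / 4 : ℝ)) (by norm_num) D
      norm_num at this ⊢
      exact this
    have hMe : (M e : ℝ) ≤ c * (3 / 4) ^ D := by
      rw [hD] at hleR
      push_cast at hleR
      nlinarith [mul_le_mul_of_nonneg_left hbern hc0,
        mul_le_mul_of_nonneg_right hu1 (Nat.cast_nonneg (α := ℝ) D)]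
    have hpow : ((3 : ℝ) / 4) ^ D * (4 / 3) ^ D = 1 := by
      rw [← mul_pow]
      norm_num
    have := mul_le_mul hMe hPD hP0 (by positivity)
    have : (c : ℝ) * (3 / 4) ^ D * (3 ^ k * (4 / 3) ^ D) = 3 ^ k * c := by
      linear_combination (3 ^ k * (c : ℝ)) * hpow
    linarith
  · obtain ⟨m, hm⟩ := Nat.exists_eq_add_of_le h
    rw [hm, pow_add, ← mul_assoc, mul_right_comm] at hthree
    have hPm : P * (3 / 2) ^ m ≤ 3 ^ k := le_of_mul_le_mul_right hthree (by positivity)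
    have hbern : 1 + (m : ℝ) * (1 / 2) ≤ (3 / 2) ^ m := by
      have := one_add_mul_le_pow (a := (1 / 2 : ℝ)) (by norm_num) m
      norm_num at this ⊢
      exact this
    have hMe : (M e : ℝ) ≤ c * (3 / 2) ^ m := by
      have hmR : (3 : ℝ) * k = s + m := by exact_mod_cast hm
      rw [hmR] at hleR
      nlinarith [mul_le_mul_of_nonneg_left hbern hc0,
        mul_le_mul_of_nonneg_right hu2 (Nat.cast_nonneg (α := ℝ) m)]
    have h1 := mul_le_mul_of_nonneg_right hMe hP0
    have h2 := mul_le_mul_of_nonneg_left hPm hc0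
    linarith

lemma mem_lengthRegion_of_lt_prod {k c : ℕ} {M : Fin (k + 1) → ℕ} {L : Fin (k + 1) → ℝ}
    (hM : ∀ i, 1 ≤ M i) (hML : ∀ i, (M i : ℝ) ≤ L i + 1) (hL : ∀ i, 1 ≤ L i)
    (hprod : 3 ^ k * c < ∏ i, M i) : L ∈ lengthRegion k c := by
  refine ⟨hL, ?_, fun e => ?_⟩
  · calc (3 : ℝ) ^ k * c < ∏ i, (M i : ℝ) := by exact_mod_cast hprod
      _ ≤ ∏ i, (L i + 1) := Finset.prod_le_prod (fun i _ => by positivity) fun i _ => hML i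
  · rcases lt_or_ge c 2 with hc | hc
    · have hc1 : (c : ℝ) ≤ 1 := by exact_mod_cast Nat.lt_succ_iff.1 hc
      rw [Nat.div_eq_of_lt hc]
      simp only [Nat.cast_zero, zero_mul, add_zero]
      exact hc1.trans (hL e)
    · have hlt : (c : ℤ) + 1 ≤ _ := lt_add_half_mul_sum hc hM hprod e
      have hltR : (c : ℝ) + 1 ≤
          M e + ((c / 2 : ℕ) : ℝ) * ∑ j ∈ Finset.univ.erase e, ((M j : ℝ) - 3) := by
        have h := Int.cast_le (R := ℝ).2 hlt
        push_cast at h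
        exact h
      have hsum : ∑ j ∈ Finset.univ.erase e, ((M j : ℝ) - 3) ≤
          ∑ j ∈ Finset.univ.erase e, (L j - 2) :=
        Finset.sum_le_sum fun j _ => by linarith [hML j]
      have := mul_le_mul_of_nonneg_left hsum (Nat.cast_nonneg (α := ℝ) (c / 2))
      linarith [hML e]

lemma prod_le_three_pow_mul_prod {k : ℕ} {X Y : Fin (k + 1) → ℝ} (hX : ∀ i, 0 ≤ X i)
    (hXY : ∀ i, X i ≤ 3 * Y i) {i p : Fin (k + 1)} (hip : p ≠ i)
    (hpair : X i * X p ≤ 3 * (Y i * Y p)) : ∏ j, X j ≤ 3 ^ k * ∏ j, Y j := by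
  have hp : p ∈ Finset.univ.erase i := Finset.mem_erase.2 ⟨hip, Finset.mem_univ p⟩
  have hY : ∀ j, 0 ≤ Y j := fun j => by linarith [hX j, hXY j]
  have hcard : k = ((Finset.univ.erase i).erase p).card + 1 := by
    rw [Finset.card_erase_add_one hp]
    simp
  have hrest : ∏ j ∈ (Finset.univ.erase i).erase p, X j ≤
      3 ^ ((Finset.univ.erase i).erase p).card * ∏ j ∈ (Finset.univ.erase i).erase p, Y j := by
    rw [← Finset.prod_const, ← Finset.prod_mul_distrib]
    exact Finset.prod_le_prod (fun j _ => hX j) fun j _ => hXY j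
  rw [← Finset.mul_prod_erase _ X (Finset.mem_univ i), ← Finset.mul_prod_erase _ X hp,
    ← Finset.mul_prod_erase _ Y (Finset.mem_univ i), ← Finset.mul_prod_erase _ Y hp,
    ← mul_assoc]
  refine (mul_le_mul hpair hrest (Finset.prod_nonneg fun j _ => hX j)
    (mul_nonneg (by norm_num) (mul_nonneg (hY i) (hY p)))).trans_eq ?_
  have hpow : (3 : ℝ) ^ k = 3 ^ ((Finset.univ.erase i).erase p).card * 3 := by
    rw [← pow_succ, ← hcard]
  rw [hpow]
  ring

lemma lt_succ_mul_prod_erase {k c : ℕ} {L : Fin (k + 1) → ℝ} (hL : L ∈ lengthRegion k c)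
    {N : Fin (k + 1) → ℕ} (hN : ∀ i, 1 ≤ N i) (hLN : ∀ i, L i < N i + 1)
    (j : Fin (k + 1)) : c < (N j + 1) * ∏ i ∈ Finset.univ.erase j, N i := by
  by_cases h : ∀ p, p ≠ j → N p = 1
  · have hone : ∏ i ∈ Finset.univ.erase j, N i = 1 :=
      Finset.prod_eq_one fun i hi => h i (Finset.ne_of_mem_erase hi)
    have hneg : ∑ i ∈ Finset.univ.erase j, (L i - 2) ≤ 0 := Finset.sum_nonpos fun i hi => by
      have := hLN i
      rw [h i (Finset.ne_of_mem_erase hi)] at this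
      norm_num at this
      linarith
    have hc := hL.2.2 j
    have := mul_nonpos_of_nonneg_of_nonpos (Nat.cast_nonneg (α := ℝ) (c / 2)) hneg
    have hlt : (c : ℝ) < (N j : ℝ) + 1 := by linarith [hLN j]
    rw [hone, mul_one]
    exact_mod_cast hlt
  · push Not at h
    obtain ⟨p, hpj, hp⟩ := h
    have hp2 : (2 : ℝ) ≤ N p := by
      have := hN p
      have : 2 ≤ N p := by omega
      exact_mod_cast this
    have hN1 : ∀ i, (1 : ℝ) ≤ N i := fun i => by exact_mod_cast hN i
    have hprod : ∏ i, ((N i : ℝ) + 2) ≤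
        3 ^ k * ∏ i, Function.update (fun i => (N i : ℝ)) j (N j + 1) i := by
      refine prod_le_three_pow_mul_prod (fun i => by positivity) (fun i => ?_) hpj ?_
      · by_cases hi : i = j
        · subst hi
          rw [Function.update_self]
          linarith [hN1 i]
        · rw [Function.update_of_ne hi]
          linarith [hN1 i]
      · rw [Function.update_self, Function.update_of_ne hpj]
        nlinarith [hN1 j]
    have hlt := hL.2.1.trans_le ((Finset.prod_le_prod (fun i _ => by linarith [hL.1 i])
      fun i _ => by linarith [hLN i]).trans hprod)
    rw [← Finset.mul_prod_erase _ _ (Finset.mem_univ j), Function.update_self,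
      Finset.prod_congr rfl fun i hi => Function.update_of_ne (Finset.ne_of_mem_erase hi) _ _]
      at hlt
    have := lt_of_mul_lt_mul_left hlt (by positivity)
    exact_mod_cast this

lemma notMem_lengthRegion_of_lt {k c : ℕ} {N : Fin (k + 1) → ℕ} (hNc : ∏ i, N i ≤ c)
    {L : Fin (k + 1) → ℝ} (hLN : ∀ i, L i < N i + 1) {i : Fin (k + 1)} (hi : L i < N i) :
    L ∉ lengthRegion k c := by
  intro hL
  have hN : ∀ j, 1 ≤ N j := fun j => by
    have := (hL.1 j).trans_lt (hLN j)
    have : (0 : ℝ) < N j := by linarith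
    exact_mod_cast this
  have hi2 : (2 : ℝ) ≤ N i := by
    have : (1 : ℝ) < N i := (hL.1 i).trans_lt hi
    exact_mod_cast this
  have hNcR : ∏ j, (N j : ℝ) ≤ c := by exact_mod_cast hNc
  by_cases h : ∀ p, p ≠ i → N p = 1
  · have hneg : ∑ j ∈ Finset.univ.erase i, (L j - 2) ≤ 0 := Finset.sum_nonpos fun j hj => by
      have := hLN j
      rw [h j (Finset.ne_of_mem_erase hj)] at this
      norm_num at this
      linarith
    have hc := hL.2.2 i
    have := mul_nonpos_of_nonneg_of_nonpos (Nat.cast_nonneg (α := ℝ) (c / 2)) hneg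
    rw [← Finset.mul_prod_erase _ _ (Finset.mem_univ i), Finset.prod_eq_one fun j hj => by
      rw [h j (Finset.ne_of_mem_erase hj), Nat.cast_one], mul_one] at hNcR
    linarith
  · push Not at h
    obtain ⟨p, hpi, hp⟩ := h
    have hp2 : (2 : ℝ) ≤ N p := by
      have := hN p
      have : 2 ≤ N p := by omega
      exact_mod_cast this
    have hN1 : ∀ j, (1 : ℝ) ≤ N j := fun j => by exact_mod_cast hN j
    have hprod : ∏ j, Function.update (fun j => (N j : ℝ) + 2) i (N i + 1) j ≤
        3 ^ k * ∏ j, (N j : ℝ) := by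
      refine prod_le_three_pow_mul_prod (fun j => ?_) (fun j => ?_) hpi ?_
      · by_cases hj : j = i
        · subst hj
          rw [Function.update_self]
          positivity
        · rw [Function.update_of_ne hj]
          positivity
      · by_cases hj : j = i
        · subst hj
          rw [Function.update_self]
          linarith [hN1 j]
        · rw [Function.update_of_ne hj]
          linarith [hN1 j]
      · rw [Function.update_self, Function.update_of_ne hpi]
        nlinarith
    have hle : ∏ j, (L j + 1) ≤ ∏ j, Function.update (fun j => (N j : ℝ) + 2) i (N i + 1) j :=
      Finset.prod_le_prod (fun j _ => by linarith [hL.1 j]) fun j _ => by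
        by_cases hj : j = i
        · subst hj
          rw [Function.update_self]
          linarith
        · rw [Function.update_of_ne hj]
          linarith [hLN j]
    have := mul_le_mul_of_nonneg_left hNcR (by positivity : (0 : ℝ) ≤ 3 ^ k)
    linarith [hL.2.1]

lemma latticeCount_intCast {d : ℕ} (a b : Fin d → ℤ) :
    latticeCount (fun i => (a i : ℝ)) (fun i => (b i : ℝ)) = ∏ i, (b i + 1 - a i).toNat := by
  simp [latticeCount_eq_prod]

lemma exists_nonneg_and_eq_zero {ι : Type*} [Finite ι] {f : ι → ℝ → ℝ}
    (hf : ∀ i, Continuous (f i)) (h0 : ∀ i, 0 ≤ f i 0) (h1 : ∃ i, f i 1 < 0) :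
    ∃ s ∈ Set.Icc (0 : ℝ) 1, (∀ i, 0 ≤ f i s) ∧ ∃ i, f i s = 0 := by
  have hcompact : IsCompact (Set.Icc (0 : ℝ) 1 ∩ ⋂ i, {s | 0 ≤ f i s}) :=
    isCompact_Icc.inter_right
      (isClosed_iInter fun i => isClosed_le continuous_const (hf i))
  obtain ⟨s, ⟨hs, hs'⟩, hmax⟩ := hcompact.exists_isGreatest
    ⟨0, ⟨le_rfl, zero_le_one⟩, Set.mem_iInter.2 h0⟩
  have hnonneg : ∀ i, 0 ≤ f i s := Set.mem_iInter.1 hs'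
  refine ⟨s, hs, hnonneg, ?_⟩
  by_contra! hne
  have hpos : ∀ i, 0 < f i s := fun i => (hnonneg i).lt_of_ne' (hne i)
  have hs1 : s < 1 := by
    refine hs.2.lt_of_ne fun h => ?_
    obtain ⟨i, hi⟩ := h1
    exact absurd (h ▸ hpos i) hi.not_gt
  have hnear : ∀ᶠ t in nhdsWithin s (Set.Ioi s), (∀ i, 0 < f i t) ∧ t < 1 ∧ s < t := by
    refine ((Filter.eventually_all.2 fun i => ?_).and ?_).and self_mem_nhdsWithin
      |>.mono fun t h => ⟨h.1.1, h.1.2, h.2⟩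
    · exact nhdsWithin_le_nhds ((hf i).continuousAt.eventually (lt_mem_nhds (hpos i)))
    · exact nhdsWithin_le_nhds (gt_mem_nhds hs1)
  obtain ⟨t, ht, ht1, hst⟩ := hnear.exists
  exact (hmax ⟨⟨hs.1.trans hst.le, ht1.le⟩, Set.mem_iInter.2 fun i => (ht i).le⟩).not_gt hst

lemma convex_setOf_sub_mem_lengthRegion (k c : ℕ) :
    Convex ℝ {p : (Fin (k + 1) → ℝ) × (Fin (k + 1) → ℝ) | p.2 - p.1 ∈ lengthRegion k c} :=
  (convex_lengthRegion k c).linear_preimage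
    (LinearMap.snd ℝ (Fin (k + 1) → ℝ) (Fin (k + 1) → ℝ) -
      LinearMap.fst ℝ (Fin (k + 1) → ℝ) (Fin (k + 1) → ℝ))

lemma ceil_le_floor_of_one_le_sub {x y : ℝ} (h : 1 ≤ y - x) : ⌈x⌉ ≤ ⌊y⌋ := by
  rw [Int.ceil_le]
  linarith [Int.lt_floor_add_one y]

lemma sub_mem_lengthRegion {k c : ℕ} {x y : Fin (k + 1) → ℝ} (hthick : ∀ i, 1 ≤ y i - x i)
    (hcount : 3 ^ k * c < latticeCount x y) : y - x ∈ lengthRegion k c := by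
  rw [latticeCount_eq_prod] at hcount
  refine mem_lengthRegion_of_lt_prod (fun i => ?_) (fun i => ?_) hthick hcount
  · have := ceil_le_floor_of_one_le_sub (hthick i)
    omega
  · have h := ceil_le_floor_of_one_le_sub (hthick i)
    have hcast : (((⌊y i⌋ + 1 - ⌈x i⌉).toNat : ℤ) : ℝ) = ((⌊y i⌋ + 1 - ⌈x i⌉ : ℤ) : ℝ) := by
      rw [Int.toNat_of_nonneg (by omega)]
    push_cast at hcast
    rw [hcast, Pi.sub_apply]
    linarith [Int.floor_le (y i), Int.le_ceil (x i)]

/-- If every box in the intersection of `F` has at most `c` lattice points, then some subfamily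
with at most `2 * (k + 1)` members has no `1`-thick box with more than `3 ^ k * c` lattice
points in its intersection. -/
lemma exists_subfamily_latticeCount_le {k c : ℕ} (F : Finset (Set (Fin (k + 1) → ℝ)))
    (hconv : ∀ A ∈ F, Convex ℝ A)
    (hbound : ∀ x y : Fin (k + 1) → ℝ, x ≤ y → (∀ A ∈ F, Set.Icc x y ⊆ A) →
      latticeCount x y ≤ c) :
    ∃ G ⊆ F, G.card ≤ 2 * (k + 1) ∧ ∀ x y : Fin (k + 1) → ℝ, (∀ i, 1 ≤ y i - x i) →
      (∀ A ∈ G, Set.Icc x y ⊆ A) → latticeCount x y ≤ 3 ^ k * c := by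
  classical
  by_contra! hloc
  have hlt : ∀ p ∈ {p : (Fin (k + 1) → ℝ) × (Fin (k + 1) → ℝ) | p.2 - p.1 ∈ lengthRegion k c},
      ∀ i, p.1 i < p.2 i := fun p hp i => by
    have := hp.1 i
    rw [Pi.sub_apply] at this
    linarith
  obtain ⟨⟨x, y⟩, hxy, hxyF⟩ := exists_Icc_subset_of_forall_card_le
    (convex_setOf_sub_mem_lengthRegion k c) hlt F hconv fun G hG hcard => by
      obtain ⟨x, y, hthick, hsub, hcount⟩ := hloc G hG hcard
      exact ⟨(x, y), sub_mem_lengthRegion hthick hcount, hsub⟩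
  dsimp only at hxyF
  set a : Fin (k + 1) → ℤ := fun i => ⌈x i⌉ with ha
  set b : Fin (k + 1) → ℤ := fun i => ⌊y i⌋ with hb
  set N : Fin (k + 1) → ℕ := fun i => (b i + 1 - a i).toNat with hN
  have hab : ∀ i, a i ≤ b i := fun i => ceil_le_floor_of_one_le_sub (hxy.1 i)
  have hNcast : ∀ i, (N i : ℝ) = b i + 1 - a i := fun i => by
    have h : ((N i : ℤ) : ℝ) = ((b i + 1 - a i : ℤ) : ℝ) := by
      rw [hN]
      dsimp only
      rw [Int.toNat_of_nonneg (by have := hab i; omega)]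
    push_cast at h
    exact h
  have hxa : ∀ i, x i ≤ a i := fun i => Int.le_ceil _
  have hby : ∀ i, (b i : ℝ) ≤ y i := fun i => Int.floor_le _
  have hprod : ∏ i, N i ≤ c := by
    rw [hN, ← latticeCount_intCast]
    refine hbound _ _ (fun i => Int.cast_le.2 (hab i)) fun A hA =>
      (Set.Icc_subset_Icc hxa hby).trans (hxyF A hA)
  have hlarge : ∀ j, c < (N j + 1) * ∏ i ∈ Finset.univ.erase j, N i :=
    lt_succ_mul_prod_erase hxy (fun i => by have := hab i; simp only [hN]; omega) fun i => by
      rw [hNcast]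
      change y i - x i < _
      linarith [Int.lt_floor_add_one (y i), Int.ceil_lt_add_one (x i)]
  have hupper : ∀ j, ∃ A ∈ F, ¬ Set.Icc (fun i => (a i : ℝ))
      (fun i => (Function.update b j (b j + 1) i : ℝ)) ⊆ A := fun j => by
    by_contra! h
    refine (hbound _ _ (fun i => ?_) h).not_gt ((hlarge j).trans_eq ?_)
    · rcases eq_or_ne i j with rfl | hi
      · have := hab i
        simp only [Function.update_self]
        exact_mod_cast (by omega : a i ≤ b i + 1)
      · simp only [Function.update_of_ne hi]
        exact_mod_cast hab i
    · rw [latticeCount_intCast, ← Finset.mul_prod_erase _ _ (Finset.mem_univ j),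
        Function.update_self]
      congr 1
      · have := hab j
        simp only [hN]
        omega
      · exact Finset.prod_congr rfl fun i hi => by
          rw [Function.update_of_ne (Finset.ne_of_mem_erase hi)]
  have hlower : ∀ j, ∃ A ∈ F, ¬ Set.Icc (fun i => (Function.update a j (a j - 1) i : ℝ))
      (fun i => (b i : ℝ)) ⊆ A := fun j => by
    by_contra! h
    refine (hbound _ _ (fun i => ?_) h).not_gt ((hlarge j).trans_eq ?_)
    · rcases eq_or_ne i j with rfl | hi
      · have := hab i
        simp only [Function.update_self]
        exact_mod_cast (by omega : a i - 1 ≤ b i)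
      · simp only [Function.update_of_ne hi]
        exact_mod_cast hab i
    · rw [latticeCount_intCast, ← Finset.mul_prod_erase _ _ (Finset.mem_univ j),
        Function.update_self]
      congr 1
      · have := hab j
        simp only [hN]
        omega
      · exact Finset.prod_congr rfl fun i hi => by
          rw [Function.update_of_ne (Finset.ne_of_mem_erase hi)]
  choose U hUF hU using hupper
  choose D hDF hD using hlower
  obtain ⟨p, q, hthick, hsub, hcount⟩ := hloc (Finset.univ.image U ∪ Finset.univ.image D)
    (Finset.union_subset (Finset.image_subset_iff.2 fun j _ => hUF j)
      (Finset.image_subset_iff.2 fun j _ => hDF j)) (by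
    refine (Finset.card_union_le _ _).trans ?_
    have h1 : (Finset.univ.image U).card ≤ k + 1 := Finset.card_image_le.trans (by simp)
    have h2 : (Finset.univ.image D).card ≤ k + 1 := Finset.card_image_le.trans (by simp)
    omega)
  have hpq : q - p ∈ lengthRegion k c := sub_mem_lengthRegion hthick hcount
  have hpath : ∀ s ∈ Set.Icc (0 : ℝ) 1,
      ((1 - s) • y + s • q) - ((1 - s) • x + s • p) ∈ lengthRegion k c := fun s hs =>
    convex_setOf_sub_mem_lengthRegion k c (x := (x, y)) hxy (y := (p, q)) hpq
      (sub_nonneg.2 hs.2) hs.1 (by ring)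
  have hpathsub : ∀ A ∈ F, Set.Icc p q ⊆ A → ∀ s ∈ Set.Icc (0 : ℝ) 1,
      Set.Icc ((1 - s) • x + s • p) ((1 - s) • y + s • q) ⊆ A := fun A hA hpqA s hs =>
    (hconv A hA).Icc_combination_subset (hlt (x, y) hxy) (hlt (p, q) hpq) (hxyF A hA) hpqA
      (sub_nonneg.2 hs.2) hs.1 (by ring)
  have hconfined : ∀ s ∈ Set.Icc (0 : ℝ) 1, (∀ i, ((1 - s) • x + s • p) i ≤ a i) →
      (∀ i, (b i : ℝ) ≤ ((1 - s) • y + s • q) i) → ∀ j,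
      ((1 - s) • y + s • q) j < b j + 1 ∧ (a j : ℝ) - 1 < ((1 - s) • x + s • p) j := by
    intro s hs hsa hsb j
    constructor
    · by_contra! h
      refine hU j ((Set.Icc_subset_Icc hsa fun i => ?_).trans (hpathsub (U j) (hUF j)
        (hsub _ (by simp)) s hs))
      rcases eq_or_ne i j with rfl | hi
      · simpa only [Function.update_self, Int.cast_add, Int.cast_one] using h
      · simpa only [Function.update_of_ne hi] using hsb i
    · by_contra! h
      refine hD j ((Set.Icc_subset_Icc (fun i => ?_) hsb).trans (hpathsub (D j) (hDF j)
        (hsub _ (by simp)) s hs))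
      rcases eq_or_ne i j with rfl | hi
      · simpa only [Function.update_self, Int.cast_sub, Int.cast_one] using h
      · simpa only [Function.update_of_ne hi] using hsa i
  by_cases hend : ∀ i, p i ≤ a i ∧ (b i : ℝ) ≤ q i
  · have hconf := hconfined 1 (by simp) (fun i => by simpa using (hend i).1)
      fun i => by simpa using (hend i).2
    have hceil : ∀ i, ⌈p i⌉ = a i := fun i =>
      Int.ceil_eq_iff.2 ⟨by simpa using (hconf i).2, (hend i).1⟩
    have hfloor : ∀ i, ⌊q i⌋ = b i := fun i =>
      Int.floor_eq_iff.2 ⟨(hend i).2, by simpa using (hconf i).1⟩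
    rw [latticeCount_eq_prod] at hcount
    simp only [hceil, hfloor] at hcount
    exact absurd (hcount.trans_le hprod) (Nat.le_mul_of_pos_left c (by positivity)).not_gt
  · obtain ⟨s, hs, hnonneg, i, hi⟩ := exists_nonneg_and_eq_zero
      (f := Sum.elim (fun i s => a i - ((1 - s) • x + s • p) i)
        (fun i s => ((1 - s) • y + s • q) i - b i))
      (by
        rintro (i | i) <;>
        · simp only [Sum.elim_inl, Sum.elim_inr, Pi.add_apply, Pi.smul_apply, smul_eq_mul]
          fun_prop)
      (by
        rintro (i | i)
        · simpa using hxa i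
        · simpa using hby i)
      (by
        push Not at hend
        obtain ⟨i, hi⟩ := hend
        by_cases hpi : p i ≤ a i
        · exact ⟨Sum.inr i, by simpa using hi hpi⟩
        · exact ⟨Sum.inl i, by simpa using hpi⟩)
    have hconf := hconfined s hs (fun i => sub_nonneg.1 (hnonneg (Sum.inl i)))
      fun i => sub_nonneg.1 (hnonneg (Sum.inr i))
    have hlength : ∀ j, (((1 - s) • y + s • q) - ((1 - s) • x + s • p)) j < N j + 1 :=
      fun j => by
        rw [hNcast, Pi.sub_apply]
        linarith [(hconf j).1, (hconf j).2]
    rcases i with i | i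
    · refine notMem_lengthRegion_of_lt hprod hlength (i := i) ?_ (hpath s hs)
      rw [hNcast, Pi.sub_apply]
      rw [Sum.elim_inl] at hi
      linarith [(hconf i).1]
    · refine notMem_lengthRegion_of_lt hprod hlength (i := i) ?_ (hpath s hs)
      rw [hNcast, Pi.sub_apply]
      rw [Sum.elim_inr] at hi
      linarith [(hconf i).2]

/-- If every subfamily of at most `2d` members of a finite family of convex sets in `ℝ^d`
has a `1`-thick axis-parallel box with at least `n` lattice points in its intersection,
then the whole family's intersection contains an axis-parallel box with at least
`n / 3^(d-1)` lattice points. -/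
theorem lower_helly_number (d n : ℕ) (hd : 1 ≤ d) (hn : 1 ≤ n)
    (F : Finset (Set (Fin d → ℝ))) (hconv : ∀ A ∈ F, Convex ℝ A)
    (hloc : ∀ G ⊆ F, G.card ≤ 2 * d →
      ∃ x y : Fin d → ℝ, x ≤ y ∧ (∀ i, (1 : ℝ) ≤ y i - x i) ∧
        (∀ A ∈ G, Set.Icc x y ⊆ A) ∧ n ≤ latticeCount x y) :
    ∃ x y : Fin d → ℝ, x ≤ y ∧ (∀ A ∈ F, Set.Icc x y ⊆ A) ∧
      (n : ℝ) / 3 ^ (d - 1) ≤ (latticeCount x y : ℝ) := by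
  obtain ⟨k, rfl⟩ : ∃ k, d = k + 1 := ⟨d - 1, by omega⟩
  rw [Nat.add_sub_cancel]
  by_contra! hnot
  have hbound : ∀ x y : Fin (k + 1) → ℝ, x ≤ y → (∀ A ∈ F, Set.Icc x y ⊆ A) →
      latticeCount x y ≤ (n - 1) / 3 ^ k := fun x y hxy hsub => by
    have h := hnot x y hxy hsub
    rw [lt_div_iff₀ (by positivity)] at h
    have hnat : latticeCount x y * 3 ^ k < n := by exact_mod_cast h
    rw [Nat.le_div_iff_mul_le (by positivity)]
    omega
  obtain ⟨G, hG, hcard, hle⟩ := exists_subfamily_latticeCount_le F hconv hbound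
  obtain ⟨x, y, -, hthick, hsub, hcount⟩ := hloc G hG hcard
  have h := hle x y hthick hsub
  have := Nat.mul_div_le (n - 1) (3 ^ k)
  omega
end

section
/- Let d ≥ 1 and n ≥ 1 be integers. Let Q = A_1 × ⋯ × A_d ⊆ ℝ^d, where each A_i ⊆ ℝ is a discrete set that is periodic with least period p_i > 0 (that is, x ∈ A_i if and only if x + p_i ∈ A_i), and let m_i = |A_i ∩ [0, p_i)| be finite and ρ(Q) = ∏_{i=1}^d m_i. Let F be a finite family of convex sets in ℝ^d. If the intersection of every subfamily of F with at most 4^d · ρ(Q)^2 members contains an axis-parallel box containing at least n points of Q, then the intersection of all members of F contains an axis-parallel box containing at least n points of Q. (In other words, H_box(Q, n) ≤ 4^d ρ(Q)^2 for every periodic product set Q.) -/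
/-- If `t ∈ C` and `s ∉ C`, then `s` is not in the hull of `C` and the midpoint of `s` and `t`. -/
theorem notMem_convexHull_insert_midpoint {E : Type*} [AddCommGroup E] [Module ℝ E] {C : Set E}
    (hC : Convex ℝ C) {s t : E} (hs : s ∉ C) (ht : t ∈ C) :
    s ∉ convexHull ℝ (insert (midpoint ℝ s t) C) := by
  intro h
  rw [convexHull_insert ⟨t, ht⟩, hC.convexHull_eq, mem_convexJoin] at h
  obtain ⟨m, rfl, c, hc, a, b, ha, hb, hab, hsum⟩ := h
  have ha2 : (0 : ℝ) < 1 - a / 2 := by linarith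
  refine hs ?_
  have key : (1 - a / 2) • s = (a / 2) • t + b • c := by
    rw [sub_smul, one_smul, sub_eq_iff_eq_add]
    nth_rewrite 1 [← hsum]
    rw [midpoint_eq_smul_add, invOf_eq_inv]
    module
  have key2 : s = ((a / 2) / (1 - a / 2)) • t + (b / (1 - a / 2)) • c := by
    rw [div_eq_inv_mul (a / 2), div_eq_inv_mul b, mul_smul, mul_smul, ← smul_add, ← key,
      smul_smul, inv_mul_cancel₀ ha2.ne', one_smul]
  rw [key2]
  refine hC ht hc (by positivity) (by positivity) ?_
  rw [← add_div, div_eq_one_iff_eq ha2.ne']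
  linarith

/-- A finite set `T` coloured so that equally coloured points have their midpoint in `T`: if any
more than `#K` convex sets (`K` the set of colours) are such that all but one of them always share
a point of `T`, then all of them share a point of `T`. -/
theorem exists_mem_of_forall_ne_of_midpoint {E ι κ : Type*} [AddCommGroup E] [Module ℝ E]
    {T : Set E} (hT : T.Finite) (c : E → κ) (K : Finset κ) (hc : ∀ t ∈ T, c t ∈ K)
    (hmid : ∀ s ∈ T, ∀ t ∈ T, c s = c t → midpoint ℝ s t ∈ T)
    (G : Finset ι) (hG : K.card < G.card) (C : ι → Set E) (hC : ∀ i, Convex ℝ (C i))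
    (h : ∀ i ∈ G, ∃ t ∈ T, ∀ j ∈ G, j ≠ i → t ∈ C j) :
    ∃ t ∈ T, ∀ i ∈ G, t ∈ C i := by
  classical
  induction hN : ∑ i ∈ G, (T \ C i).ncard using Nat.strong_induction_on generalizing C with
  | _ N ih =>
  by_contra! hno
  have hchoice : ∀ i ∈ G, ∃ s, (s ∈ T ∧ ∀ j ∈ G, j ≠ i → s ∈ C j) ∧
      ∀ t, (t ∈ T ∧ ∀ j ∈ G, j ≠ i → t ∈ C j) →
        (T ∩ convexHull ℝ (insert s (C i))).ncard ≤
          (T ∩ convexHull ℝ (insert t (C i))).ncard := fun i hi =>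
    Set.exists_min_image {t | t ∈ T ∧ ∀ j ∈ G, j ≠ i → t ∈ C j} _
      (hT.subset fun _ ht => ht.1) (h i hi)
  choose! s hs hsmin using hchoice
  have hsC : ∀ i ∈ G, s i ∉ C i := by
    intro i hi hsi
    obtain ⟨j, hj, hsj⟩ := hno (s i) (hs i hi).1
    by_cases hji : j = i
    · exact hsj (hji ▸ hsi)
    · exact hsj ((hs i hi).2 j hj hji)
  have key : ∀ i ∈ G, ∀ j ∈ G, i ≠ j → c (s i) = c (s j) →
      midpoint ℝ (s i) (s j) ∈ C i := by
    intro i hi j hj hij hcol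
    by_contra hm
    set m := midpoint ℝ (s i) (s j) with hmdef
    have hmT : m ∈ T := hmid _ (hs i hi).1 _ (hs j hj).1 hcol
    have hsj : s j ∈ C i := (hs j hj).2 i hi hij
    set C' := Function.update C i (convexHull ℝ (insert m (C i))) with hC'
    have hle : ∀ l, C l ⊆ C' l := by
      intro l
      by_cases hl : l = i
      · subst hl
        rw [hC', Function.update_self]
        exact (Set.subset_insert _ _).trans (subset_convexHull ℝ _)
      · rw [hC', Function.update_of_ne hl]
    have hconv' : ∀ l, Convex ℝ (C' l) := by
      intro l
      by_cases hl : l = i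
      · subst hl
        rw [hC', Function.update_self]
        exact convex_convexHull ℝ _
      · rw [hC', Function.update_of_ne hl]
        exact hC l
    have hlt : ∑ l ∈ G, (T \ C' l).ncard < N := by
      rw [← hN]
      refine Finset.sum_lt_sum (fun l _ => Set.ncard_le_ncard
        (Set.sdiff_subset_sdiff_right (hle l)) hT.sdiff) ⟨i, hi, ?_⟩
      refine Set.ncard_lt_ncard ⟨Set.sdiff_subset_sdiff_right (hle i), fun hsub => ?_⟩ hT.sdiff
      refine (hsub ⟨hmT, hm⟩).2 ?_
      rw [hC', Function.update_self]
      exact subset_convexHull ℝ _ (Set.mem_insert _ _)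
    obtain ⟨t, htT, ht⟩ := ih _ hlt C' hconv' (fun l hl => by
      obtain ⟨t, htT, ht⟩ := h l hl
      exact ⟨t, htT, fun k hk hkl => hle k (ht k hk hkl)⟩) rfl
    have hti : t ∈ convexHull ℝ (insert m (C i)) := by
      have := ht i hi
      rwa [hC', Function.update_self] at this
    have htR : ∀ k ∈ G, k ≠ i → t ∈ C k := by
      intro k hk hki
      have := ht k hk
      rwa [hC', Function.update_of_ne hki] at this
    have hsub1 : convexHull ℝ (insert t (C i)) ⊆ convexHull ℝ (insert m (C i)) :=
      convexHull_min (Set.insert_subset hti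
        ((Set.subset_insert _ _).trans (subset_convexHull ℝ _))) (convex_convexHull ℝ _)
    have hsub2 : convexHull ℝ (insert m (C i)) ⊆ convexHull ℝ (insert (s i) (C i)) := by
      refine convexHull_min (Set.insert_subset ?_
        ((Set.subset_insert _ _).trans (subset_convexHull ℝ _))) (convex_convexHull ℝ _)
      exact (convex_convexHull ℝ _).midpoint_mem
        (subset_convexHull ℝ _ (Set.mem_insert _ _))
        (subset_convexHull ℝ _ (Set.mem_insert_of_mem _ hsj))
    refine (hsmin i hi t ⟨htT, htR⟩).not_gt (Set.ncard_lt_ncard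
      ⟨Set.inter_subset_inter_right _ (hsub1.trans hsub2), fun hsub => ?_⟩ (hT.inter_of_left _))
    exact notMem_convexHull_insert_midpoint (hC i) (hsC i hi) hsj
      (hsub1 (hsub ⟨(hs i hi).1, subset_convexHull ℝ _ (Set.mem_insert _ _)⟩).2)
  obtain ⟨i, hi, j, hj, hij, hcol⟩ := Finset.exists_ne_map_eq_of_card_lt_of_maps_to hG
    (f := fun i => c (s i)) (fun i hi => hc _ (hs i hi).1)
  obtain ⟨l, hl, hml⟩ := hno _ (hmid _ (hs i hi).1 _ (hs j hj).1 hcol)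
  refine hml ?_
  by_cases hli : l = i
  · exact hli ▸ key i hi j hj hij hcol
  by_cases hlj : l = j
  · rw [midpoint_comm]
    exact hlj ▸ key j hj i hi hij.symm hcol.symm
  · exact (hC l).midpoint_mem ((hs i hi).2 l hl hli) ((hs j hj).2 l hl hlj)

/-- Helly-type theorem for a finite set coloured so that equally coloured points have their
midpoint in the set: the Helly number is at most the number of colours. -/
theorem helly_of_midpoint {E ι κ : Type*} [AddCommGroup E] [Module ℝ E]
    {T : Set E} (hT : T.Finite) (c : E → κ) (K : Finset κ) (hc : ∀ t ∈ T, c t ∈ K)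
    (hmid : ∀ s ∈ T, ∀ t ∈ T, c s = c t → midpoint ℝ s t ∈ T)
    (F : Finset ι) (C : ι → Set E) (hC : ∀ i ∈ F, Convex ℝ (C i))
    (h : ∀ G ⊆ F, G.card ≤ K.card → ∃ t ∈ T, ∀ i ∈ G, t ∈ C i) :
    ∃ t ∈ T, ∀ i ∈ F, t ∈ C i := by
  classical
  suffices ∀ G ⊆ F, ∃ t ∈ T, ∀ i ∈ G, t ∈ C i from this F subset_rfl
  intro G
  induction G using Finset.strongInduction with
  | _ G ih =>
  intro hGF
  by_cases hG : G.card ≤ K.card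
  · exact h G hGF hG
  obtain ⟨t, htT, ht⟩ := exists_mem_of_forall_ne_of_midpoint hT c K hc hmid G (not_le.1 hG)
    (fun i => if i ∈ F then C i else Set.univ)
    (fun i => by
      split_ifs with hi
      exacts [hC i hi, convex_univ])
    (fun i hi => by
      obtain ⟨t, htT, ht⟩ := ih (G.erase i) (Finset.erase_ssubset hi)
        ((Finset.erase_subset _ _).trans hGF)
      refine ⟨t, htT, fun j hj hji => ?_⟩
      rw [if_pos (hGF hj)]
      exact ht j (Finset.mem_erase.2 ⟨hji, hj⟩))
  refine ⟨t, htT, fun i hi => ?_⟩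
  have := ht i hi
  rwa [if_pos (hGF hi)] at this

/-- The boxes contained in a convex set form a convex set of pairs of corners. -/
theorem convex_setOf_Icc_subset {ι : Type*} {C : Set (ι → ℝ)} (hC : Convex ℝ C) :
    Convex ℝ {e : (ι → ℝ) × (ι → ℝ) | e.1 ≤ e.2 ∧ Set.Icc e.1 e.2 ⊆ C} := by
  rintro ⟨x, y⟩ ⟨hxy, hsub⟩ ⟨x', y'⟩ ⟨hxy', hsub'⟩ a b ha hb hab
  have hle : a • x + b • x' ≤ a • y + b • y' :=
    add_le_add (smul_le_smul_of_nonneg_left hxy ha) (smul_le_smul_of_nonneg_left hxy' hb)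
  refine ⟨hle, fun z hz => ?_⟩
  have hcoord : ∀ i, ∃ u u' : ℝ, u ∈ Set.Icc (x i) (y i) ∧ u' ∈ Set.Icc (x' i) (y' i) ∧
      a * u + b * u' = z i := by
    intro i
    have hzi : z i ∈ segment ℝ (a * x i + b * x' i) (a * y i + b * y' i) := by
      rw [segment_eq_Icc (by simpa using hle i)]
      exact ⟨hz.1 i, hz.2 i⟩
    obtain ⟨s, t, hs, ht, hst, hsum⟩ := hzi
    refine ⟨s * x i + t * y i, s * x' i + t * y' i, ?_, ?_, ?_⟩
    · rw [← segment_eq_Icc (hxy i)]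
      exact ⟨s, t, hs, ht, hst, rfl⟩
    · rw [← segment_eq_Icc (hxy' i)]
      exact ⟨s, t, hs, ht, hst, rfl⟩
    · rw [← hsum, smul_eq_mul, smul_eq_mul]
      ring
  choose u u' hu hu' hz' using hcoord
  have : z = a • u + b • u' := funext fun i => (hz' i).symm
  rw [this]
  exact hC (hsub ⟨fun i => (hu i).1, fun i => (hu i).2⟩)
    (hsub' ⟨fun i => (hu' i).1, fun i => (hu' i).2⟩) ha hb hab

/-- A set of reals without accumulation points is locally finite. -/
theorem finite_inter_Icc_of_forall_not_accPt {A : Set ℝ}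
    (hA : ∀ x, ¬ AccPt x (Filter.principal A)) (a b : ℝ) : (A ∩ Set.Icc a b).Finite := by
  by_contra h
  obtain ⟨x, -, hx⟩ := Set.Infinite.exists_accPt_of_subset_isCompact h
    (isCompact_Icc (a := a) (b := b)) Set.inter_subset_right
  exact hA x (hx.mono (Filter.principal_mono.2 Set.inter_subset_left))

theorem mem_iff_add_int_mul_mem {A : Set ℝ} {p : ℝ} (hper : ∀ x, x ∈ A ↔ x + p ∈ A)
    (k : ℤ) (x : ℝ) : x ∈ A ↔ x + k * p ∈ A := by
  have h : Function.Periodic (fun x => x ∈ A) p := fun x => propext (hper x).symm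
  exact (iff_of_eq (h.int_mul k x)).symm

theorem ncard_inter_Ioc_add_period {A : Set ℝ} {p : ℝ} (hp : 0 < p)
    (hper : ∀ x, x ∈ A ↔ x + p ∈ A) (b : ℝ) :
    (A ∩ Set.Ioc b (b + p)).ncard = (A ∩ Set.Ico 0 p).ncard := by
  have hmod : ∀ x, toIcoMod hp 0 x ∈ A ↔ x ∈ A := fun x => by
    rw [mem_iff_add_int_mul_mem hper (toIcoDiv hp 0 x), ← zsmul_eq_mul,
      toIcoMod_add_toIcoDiv_zsmul]
  refine Set.BijOn.ncard_eq (f := toIcoMod hp 0) ⟨?_, ?_, ?_⟩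
  · exact fun x hx => ⟨(hmod x).2 hx.1, toIcoMod_mem_Ico' hp x⟩
  · intro x hx y hy hxy
    rw [← (toIocMod_eq_self hp).2 hx.2, ← (toIocMod_eq_self hp).2 hy.2]
    exact (toIocMod_eq_toIocMod hp).2 ((toIcoMod_eq_toIcoMod hp).1 hxy)
  · intro y hy
    refine ⟨toIocMod hp b y, ⟨?_, toIocMod_mem_Ioc hp b y⟩, ?_⟩
    · rw [mem_iff_add_int_mul_mem hper (toIocDiv hp b y), ← zsmul_eq_mul,
        toIocMod_add_toIocDiv_zsmul]
      exact hy.1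
    · rw [toIcoMod_toIocMod]
      exact (toIcoMod_eq_self hp).2 (by simpa using hy.2)

theorem ncard_inter_Icc_add_nat_mul {A : Set ℝ} {p : ℝ} (hp : 0 < p)
    (hA : ∀ x, ¬ AccPt x (Filter.principal A)) (hper : ∀ x, x ∈ A ↔ x + p ∈ A) {a b : ℝ}
    (hab : a ≤ b) (k : ℕ) :
    (A ∩ Set.Icc a (b + k * p)).ncard =
      (A ∩ Set.Icc a b).ncard + k * (A ∩ Set.Ico 0 p).ncard := by
  induction k with
  | zero => simp
  | succ k ih =>
    have hk : b ≤ b + k * p := by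
      have : 0 ≤ k * p := by positivity
      linarith
    have hsplit : A ∩ Set.Icc a (b + (k + 1 : ℕ) * p) =
        (A ∩ Set.Icc a (b + k * p)) ∪ (A ∩ Set.Ioc (b + k * p) (b + k * p + p)) := by
      rw [← Set.inter_union_distrib_left, Set.Icc_union_Ioc_eq_Icc (hab.trans hk) (by linarith)]
      push_cast
      ring_nf
    rw [hsplit, Set.ncard_union_eq _ (finite_inter_Icc_of_forall_not_accPt hA _ _)
      ((finite_inter_Icc_of_forall_not_accPt hA _ _).subset
        (Set.inter_subset_inter_right _ Set.Ioc_subset_Icc_self)), ih,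
      ncard_inter_Ioc_add_period hp hper]
    · ring
    · refine Set.disjoint_left.2 fun x hx hx' => ?_
      exact absurd hx.2.2 (not_le.2 hx'.2.1)

theorem ncard_inter_Icc_add_int_mul {A : Set ℝ} {p : ℝ} (hper : ∀ x, x ∈ A ↔ x + p ∈ A)
    (a b : ℝ) (k : ℤ) :
    (A ∩ Set.Icc (a + k * p) (b + k * p)).ncard = (A ∩ Set.Icc a b).ncard := by
  have : A ∩ Set.Icc (a + k * p) (b + k * p) = (fun x => x + k * p) '' (A ∩ Set.Icc a b) := by
    ext x
    constructor
    · rintro ⟨hx, h1, h2⟩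
      refine ⟨x - k * p, ⟨?_, by linarith, by linarith⟩, by ring⟩
      rwa [mem_iff_add_int_mul_mem hper k, sub_add_cancel]
    · rintro ⟨y, ⟨hy, h1, h2⟩, rfl⟩
      exact ⟨(mem_iff_add_int_mul_mem hper k y).1 hy, by linarith, by linarith⟩
  rw [this, Set.ncard_image_of_injective _ (add_left_injective _)]

/-- On intervals whose endpoints are congruent modulo `2p`, the number of points of a
`p`-periodic set is affine under taking midpoints. -/
theorem two_mul_ncard_inter_Icc_midpoint {A : Set ℝ} {p : ℝ} (hp : 0 < p)
    (hA : ∀ x, ¬ AccPt x (Filter.principal A)) (hper : ∀ x, x ∈ A ↔ x + p ∈ A) {a b : ℝ}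
    (k l : ℤ) (hab : a ≤ b) (hab' : a + 2 * k * p ≤ b + 2 * l * p) :
    2 * (A ∩ Set.Icc (a + k * p) (b + l * p)).ncard =
      (A ∩ Set.Icc a b).ncard + (A ∩ Set.Icc (a + 2 * k * p) (b + 2 * l * p)).ncard := by
  wlog hkl : k ≤ l generalizing a b k l
  · have := this (a := a + 2 * k * p) (b := b + 2 * l * p) (-k) (-l) hab'
      (by push_cast; linarith) (by omega)
    push_cast at this
    ring_nf at this ⊢
    rw [this]
  obtain ⟨j, rfl⟩ := Int.le.dest hkl
  have h1 : (A ∩ Set.Icc (a + k * p) (b + (k + j : ℤ) * p)).ncard =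
      (A ∩ Set.Icc a b).ncard + j * (A ∩ Set.Ico 0 p).ncard := by
    rw [← ncard_inter_Icc_add_nat_mul hp hA hper hab,
      ← ncard_inter_Icc_add_int_mul hper a _ k]
    push_cast
    ring_nf
  have h2 : (A ∩ Set.Icc (a + 2 * k * p) (b + 2 * (k + j : ℤ) * p)).ncard =
      (A ∩ Set.Icc a b).ncard + (2 * j : ℕ) * (A ∩ Set.Ico 0 p).ncard := by
    rw [← ncard_inter_Icc_add_nat_mul hp hA hper hab,
      ← ncard_inter_Icc_add_int_mul hper a _ (2 * k)]
    push_cast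
    ring_nf
  rw [h1, h2]
  ring

theorem ncard_inter_Ico_two_mul {A : Set ℝ} {p : ℝ} (hp : 0 < p)
    (hfin : (A ∩ Set.Ico 0 p).Finite) (hper : ∀ x, x ∈ A ↔ x + p ∈ A) :
    (A ∩ Set.Ico 0 (2 * p)).ncard = 2 * (A ∩ Set.Ico 0 p).ncard := by
  have hsplit : A ∩ Set.Ico 0 (2 * p) =
      (A ∩ Set.Ico 0 p) ∪ (fun x => x + p) '' (A ∩ Set.Ico 0 p) := by
    ext x
    constructor
    · rintro ⟨hx, h1, h2⟩
      by_cases hxp : x < p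
      · exact Or.inl ⟨hx, h1, hxp⟩
      · refine Or.inr ⟨x - p, ⟨?_, by linarith, by linarith⟩, by ring⟩
        rwa [hper, sub_add_cancel]
    · rintro (⟨hx, h1, h2⟩ | ⟨y, ⟨hy, h1, h2⟩, rfl⟩)
      · exact ⟨hx, h1, by linarith⟩
      · exact ⟨(hper y).1 hy, by simp only; linarith, by simp only; linarith⟩
  rw [hsplit, Set.ncard_union_eq _ hfin (hfin.image _),
    Set.ncard_image_of_injective _ (add_left_injective _)]
  · ring
  · refine Set.disjoint_left.2 ?_
    rintro x ⟨_, _, h2⟩ ⟨y, ⟨_, h3, _⟩, rfl⟩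
    simp only at h2
    linarith

theorem ncard_Icc_inter_setOf_forall_mem {ι : Type*} [Fintype ι] (A : ι → Set ℝ)
    (x y : ι → ℝ) :
    (Set.Icc x y ∩ {z | ∀ i, z i ∈ A i}).ncard = ∏ i, (A i ∩ Set.Icc (x i) (y i)).ncard := by
  have : Set.Icc x y ∩ {z | ∀ i, z i ∈ A i} =
      Set.univ.pi fun i => A i ∩ Set.Icc (x i) (y i) := by
    ext z
    simp only [Set.mem_inter_iff, Set.mem_Icc, Pi.le_def, Set.mem_ofPred_eq, Set.mem_pi,
      Set.mem_univ, true_imp_iff]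
    grind
  rw [this, ← Nat.card_coe_set_eq, Nat.card_congr (Equiv.Set.univPi _), Nat.card_pi]
  simp only [Nat.card_coe_set_eq]

theorem le_prod_of_two_mul_eq_add {ι : Type*} [Fintype ι] {f g h : ι → ℕ} {n : ℕ}
    (hh : ∀ i, 2 * h i = f i + g i) (hf : n ≤ ∏ i, f i) (hg : n ≤ ∏ i, g i) :
    n ≤ ∏ i, h i := by
  refine (Nat.pow_le_pow_iff_left two_ne_zero).1 ?_
  calc n ^ 2 = n * n := sq n
    _ ≤ (∏ i, f i) * ∏ i, g i := Nat.mul_le_mul hf hg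
    _ = ∏ i, f i * g i := Finset.prod_mul_distrib.symm
    _ ≤ ∏ i, h i ^ 2 := Finset.prod_le_prod' fun i _ => by
        have := hh i
        zify at this ⊢
        nlinarith [sq_nonneg ((f i : ℤ) - g i)]
    _ = (∏ i, h i) ^ 2 := Finset.prod_pow _ _ _

/-- An interval that meets a locally finite set `A` can be shrunk to have its endpoints in `A`
without losing any point of `A`. -/
theorem exists_Icc_subset_of_inter_nonempty {A : Set ℝ} {a b : ℝ}
    (hfin : (A ∩ Set.Icc a b).Finite) (hne : (A ∩ Set.Icc a b).Nonempty) :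
    ∃ a' ∈ A, ∃ b' ∈ A, a ≤ a' ∧ a' ≤ b' ∧ b' ≤ b ∧ A ∩ Set.Icc a b ⊆ Set.Icc a' b' := by
  obtain ⟨a', ha', hmin⟩ := Set.exists_min_image _ id hfin hne
  obtain ⟨b', hb', hmax⟩ := Set.exists_max_image _ id hfin hne
  exact ⟨a', ha'.1, b', hb'.1, ha'.2.1, hmin b' hb', hb'.2.2, fun x hx => ⟨hmin x hx, hmax x hx⟩⟩

/-- `H_box(Q, n) ≤ 4^d · ρ(Q)²` for a periodic product set
`Q = A₁ × ⋯ × A_d ⊆ ℝ^d`, where each `Aᵢ ⊆ ℝ` is discrete (has no accumulation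
points) and periodic with least period `pᵢ > 0`, `mᵢ = |Aᵢ ∩ [0, pᵢ)|` is finite, and
`ρ(Q) = ∏ mᵢ`. -/
theorem box_helly_periodic_product_set (d n : ℕ) (hd : 1 ≤ d) (hn : 1 ≤ n)
    (A : Fin d → Set ℝ) (p : Fin d → ℝ)
    (hdisc : ∀ i, ∀ x : ℝ, ¬ AccPt x (Filter.principal (A i)))
    (hp : ∀ i, 0 < p i)
    (hper : ∀ i, ∀ x : ℝ, x ∈ A i ↔ x + p i ∈ A i)
    (hleast : ∀ i, ∀ q : ℝ, 0 < q → (∀ x : ℝ, x ∈ A i ↔ x + q ∈ A i) → p i ≤ q)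
    (hfin : ∀ i, (A i ∩ Set.Ico 0 (p i)).Finite)
    (F : Finset (Set (Fin d → ℝ))) (hconv : ∀ C ∈ F, Convex ℝ C)
    (hloc : ∀ G ⊆ F, G.card ≤ 4 ^ d * (∏ i, (A i ∩ Set.Ico 0 (p i)).ncard) ^ 2 →
      ∃ x y : Fin d → ℝ, x ≤ y ∧ (∀ C ∈ G, Set.Icc x y ⊆ C) ∧
        n ≤ (Set.Icc x y ∩ {z : Fin d → ℝ | ∀ i, z i ∈ A i}).ncard) :
    ∃ x y : Fin d → ℝ, x ≤ y ∧ (∀ C ∈ F, Set.Icc x y ⊆ C) ∧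
      n ≤ (Set.Icc x y ∩ {z : Fin d → ℝ | ∀ i, z i ∈ A i}).ncard := by
  classical
  have hfinIcc := fun i => finite_inter_Icc_of_forall_not_accPt (hdisc i)
  have hp2 : ∀ i, 0 < 2 * p i := fun i => mul_pos two_pos (hp i)
  have hper2 : ∀ i (x : ℝ), x ∈ A i ↔ x + 2 * p i ∈ A i := fun i x => by
    simpa using mem_iff_add_int_mul_mem (hper i) 2 x
  have hB : ∀ i, (A i ∩ Set.Ico 0 (2 * p i)).Finite := fun i =>
    (hfinIcc i 0 (2 * p i)).subset (Set.inter_subset_inter_right _ Set.Ico_subset_Icc_self)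
  set K := (Fintype.piFinset fun i => (hB i).toFinset) ×ˢ
    (Fintype.piFinset fun i => (hB i).toFinset) with hK
  have hKcard : K.card = 4 ^ d * (∏ i, (A i ∩ Set.Ico 0 (p i)).ncard) ^ 2 := by
    rw [hK, Finset.card_product, Fintype.card_piFinset]
    simp only [← Set.ncard_eq_toFinset_card _ (hB _),
      ncard_inter_Ico_two_mul (hp _) (hfin _) (hper _)]
    rw [Finset.prod_mul_distrib, Finset.prod_const, Finset.card_univ, Fintype.card_fin,
      show 4 = 2 * 2 from rfl, mul_pow]
    ring
  have hloc' : ∀ G ∈ F.powerset, ∃ e : (Fin d → ℝ) × (Fin d → ℝ), G.card ≤ K.card →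
      ((∀ i, e.1 i ∈ A i) ∧ (∀ i, e.2 i ∈ A i) ∧ e.1 ≤ e.2 ∧
        n ≤ ∏ i, (A i ∩ Set.Icc (e.1 i) (e.2 i)).ncard) ∧ ∀ C ∈ G, Set.Icc e.1 e.2 ⊆ C := by
    intro G hG
    by_cases hGK : G.card ≤ K.card
    swap
    · exact ⟨0, fun h => absurd h hGK⟩
    obtain ⟨x, y, -, hsub, hcard⟩ := hloc G (Finset.mem_powerset.1 hG) (hKcard ▸ hGK)
    rw [ncard_Icc_inter_setOf_forall_mem] at hcard
    have hne : ∀ i, (A i ∩ Set.Icc (x i) (y i)).Nonempty := fun i => by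
      refine Set.nonempty_of_ncard_ne_zero fun h0 => ?_
      rw [Finset.prod_eq_zero (Finset.mem_univ i) h0] at hcard
      omega
    choose x' hx' y' hy' hxx' hxy' hyy' hsub' using fun i =>
      exists_Icc_subset_of_inter_nonempty (hfinIcc i (x i) (y i)) (hne i)
    refine ⟨(x', y'), fun _ => ⟨⟨hx', hy', hxy', hcard.trans ?_⟩, fun C hC =>
      (Set.Icc_subset_Icc hxx' hyy').trans (hsub C hC)⟩⟩
    exact Finset.prod_le_prod' fun i _ => Set.ncard_le_ncard
      (Set.subset_inter Set.inter_subset_left (hsub' i)) (hfinIcc i _ _)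
  choose! e he using hloc'
  obtain ⟨L, hL⟩ := (F.powerset.finite_toSet.image e).bddBelow
  obtain ⟨U, hU⟩ := (F.powerset.finite_toSet.image e).bddAbove
  set T : Set ((Fin d → ℝ) × (Fin d → ℝ)) := {e | e ∈ Set.Icc L U ∧ (∀ i, e.1 i ∈ A i) ∧
    (∀ i, e.2 i ∈ A i) ∧ e.1 ≤ e.2 ∧ n ≤ ∏ i, (A i ∩ Set.Icc (e.1 i) (e.2 i)).ncard}
  have hT : T.Finite := by
    refine ((Set.Finite.pi' fun i => hfinIcc i (L.1 i) (U.1 i)).prod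
      (Set.Finite.pi' fun i => hfinIcc i (L.2 i) (U.2 i))).subset ?_
    rintro e ⟨⟨hLe, heU⟩, h1, h2, -, -⟩
    exact ⟨fun i => ⟨h1 i, hLe.1 i, heU.1 i⟩, fun i => ⟨h2 i, hLe.2 i, heU.2 i⟩⟩
  have hmod : ∀ i x, x ∈ A i → toIcoMod (hp2 i) 0 x ∈ A i ∩ Set.Ico 0 (2 * p i) := by
    intro i x hx
    refine ⟨?_, toIcoMod_mem_Ico' _ x⟩
    rw [mem_iff_add_int_mul_mem (hper2 i) (toIcoDiv (hp2 i) 0 x), ← zsmul_eq_mul,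
      toIcoMod_add_toIcoDiv_zsmul]
    exact hx
  suffices h : ∃ t ∈ T, ∀ C ∈ F,
      t ∈ {e : (Fin d → ℝ) × (Fin d → ℝ) | e.1 ≤ e.2 ∧ Set.Icc e.1 e.2 ⊆ C} by
    obtain ⟨t, ht, htF⟩ := h
    refine ⟨t.1, t.2, ht.2.2.2.1, fun C hC => (htF C hC).2, ?_⟩
    rw [ncard_Icc_inter_setOf_forall_mem]
    exact ht.2.2.2.2
  refine helly_of_midpoint hT
    (fun e => ((fun i => toIcoMod (hp2 i) 0 (e.1 i)), fun i => toIcoMod (hp2 i) 0 (e.2 i)))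
    K ?_ ?_ F (fun C => {e | e.1 ≤ e.2 ∧ Set.Icc e.1 e.2 ⊆ C})
    (fun C hC => convex_setOf_Icc_subset (hconv C hC)) ?_
  · rintro e ⟨-, h1, h2, -, -⟩
    simp only [hK, Finset.mem_product, Fintype.mem_piFinset, Set.Finite.mem_toFinset]
    exact ⟨fun i => hmod i _ (h1 i), fun i => hmod i _ (h2 i)⟩
  · rintro ⟨x, y⟩ ⟨hI, hx, hy, hxy, hn1⟩ ⟨x', y'⟩ ⟨hI', hx', hy', hxy', hn2⟩ hcol
    simp only [Prod.mk.injEq, funext_iff, toIcoMod_eq_toIcoMod, zsmul_eq_mul] at hcol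
    obtain ⟨hk, hl⟩ := hcol
    choose k hk using hk
    choose l hl using hl
    have hx'e : ∀ i, x' i = x i + 2 * k i * p i := fun i => by linarith [hk i]
    have hy'e : ∀ i, y' i = y i + 2 * l i * p i := fun i => by linarith [hl i]
    have hm : midpoint ℝ (x, y) (x', y') =
        ((fun i => x i + k i * p i), fun i => y i + l i * p i) := by
      rw [midpoint_eq_smul_add, invOf_eq_inv]
      ext i
      · simp only [Prod.mk_add_mk, Prod.smul_mk, Pi.smul_apply, Pi.add_apply, smul_eq_mul, hx'e]
        ring
      · simp only [Prod.mk_add_mk, Prod.smul_mk, Pi.smul_apply, Pi.add_apply, smul_eq_mul, hy'e]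
        ring
    have hmI := (convex_Icc (𝕜 := ℝ) L U).midpoint_mem hI hI'
    rw [hm] at hmI ⊢
    refine ⟨hmI, fun i => (mem_iff_add_int_mul_mem (hper i) _ _).1 (hx i),
      fun i => (mem_iff_add_int_mul_mem (hper i) _ _).1 (hy i), fun i => ?_, ?_⟩
    · have h1 := hxy i
      have h2 := hxy' i
      simp only [hx'e, hy'e] at h1 h2 ⊢
      linarith
    · refine le_prod_of_two_mul_eq_add (fun i => ?_) hn1 hn2
      have h2 := hxy' i
      simp only [hx'e, hy'e] at h2 ⊢
      exact two_mul_ncard_inter_Icc_midpoint (hp i) (hdisc i) (hper i) _ _ (hxy i) h2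
  · intro G hG hGK
    have hGF := Finset.mem_powerset.2 hG
    obtain ⟨h1, h2⟩ := he G hGF hGK
    have hmem : e G ∈ e '' (F.powerset : Set (Finset (Set (Fin d → ℝ)))) :=
      Set.mem_image_of_mem _ hGF
    exact ⟨e G, ⟨⟨hL hmem, hU hmem⟩, h1⟩, fun C hC => ⟨h1.2.2.1, h2 C hC⟩⟩
end

section
/- Let N ≥ 1 and let S, T ⊆ ℝ^N. Suppose h_S ∈ ℕ is a Helly bound for S and h_T ∈ ℕ is a Helly bound for T. Then h_S + h_T is a Helly bound for S ∪ T. (In other words, H(S ∪ T) ≤ H(S) + H(T).) -/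
/-- `h` is a Helly bound for `S ⊆ ℝ^N`: for every finite family `F` of convex sets in
`ℝ^N`, if the intersection of every subfamily of at most `h` members of `F` contains a
point of `S`, then the intersection of all members of `F` contains a point of `S`. -/
def HellyBound (N : ℕ) (S : Set (Fin N → ℝ)) (h : ℕ) : Prop :=
  ∀ F : Finset (Set (Fin N → ℝ)), (∀ A ∈ F, Convex ℝ A) →
    (∀ G ⊆ F, G.card ≤ h → ∃ p ∈ S, ∀ A ∈ G, p ∈ A) →
    ∃ p ∈ S, ∀ A ∈ F, p ∈ A

/-- Union bound for Helly numbers: `H(S ∪ T) ≤ H(S) + H(T)`. -/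
theorem helly_union_bound (N : ℕ) (hN : 1 ≤ N) (S T : Set (Fin N → ℝ)) (hS hT : ℕ)
    (h1 : HellyBound N S hS) (h2 : HellyBound N T hT) :
    HellyBound N (S ∪ T) (hS + hT) := by
  classical
  intro F hF hG
  by_contra hne
  have hSne : ¬ ∃ p ∈ S, ∀ A ∈ F, p ∈ A := fun ⟨p, hp, hpF⟩ => hne ⟨p, Or.inl hp, hpF⟩
  have hTne : ¬ ∃ p ∈ T, ∀ A ∈ F, p ∈ A := fun ⟨p, hp, hpF⟩ => hne ⟨p, Or.inr hp, hpF⟩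
  refine hSne (h1 F hF fun G₁ hG₁ hc₁ => ?_)
  by_contra hG₁ne
  refine hTne (h2 F hF fun G₂ hG₂ hc₂ => ?_)
  obtain ⟨p, hp | hp, hpG⟩ := hG (G₁ ∪ G₂) (Finset.union_subset hG₁ hG₂)
    ((Finset.card_union_le G₁ G₂).trans (add_le_add hc₁ hc₂))
  · exact absurd ⟨p, hp, fun A hA => hpG A (Finset.mem_union_left _ hA)⟩ hG₁ne
  · exact ⟨p, hp, fun A hA => hpG A (Finset.mem_union_right _ hA)⟩
end

section
/- Let N ≥ 1, let S ⊆ ℝ^N, and let C ⊆ ℝ^N be convex. If h ∈ ℕ is a Helly bound for S, then h is a Helly bound for S ∩ C. (In other words, H(S ∩ C) ≤ H(S).) -/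
/-- Intersecting with a convex set does not increase the Helly number:
`H(S ∩ C) ≤ H(S)` for convex `C`. -/
theorem helly_convex_intersection (N : ℕ) (hN : 1 ≤ N) (S C : Set (Fin N → ℝ))
    (hC : Convex ℝ C) (h : ℕ) (hS : HellyBound N S h) :
    HellyBound N (S ∩ C) h := by
  classical
  intro F hF hG
  rcases F.eq_empty_or_nonempty with rfl | ⟨A₀, hA₀⟩
  · exact hG ∅ subset_rfl (by simp)
  obtain ⟨p, hpS, hp⟩ := hS (F.image (· ∩ C))
    (by
      intro B hB
      obtain ⟨A, hA, rfl⟩ := Finset.mem_image.1 hB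
      exact (hF A hA).inter hC)
    (by
      intro G hGF hcard
      have hpre : ∀ B ∈ G, ∃ A ∈ F, A ∩ C = B := fun B hB => Finset.mem_image.1 (hGF hB)
      choose! f hfF hf using hpre
      obtain ⟨p, hp, hpG⟩ := hG (G.image f) (Finset.image_subset_iff.2 hfF)
        (Finset.card_image_le.trans hcard)
      refine ⟨p, hp.1, fun B hB => ?_⟩
      rw [← hf B hB]
      exact ⟨hpG _ (Finset.mem_image_of_mem f hB), hp.2⟩)
  have hpF : ∀ A ∈ F, p ∈ A ∩ C := fun A hA => hp _ (Finset.mem_image_of_mem (· ∩ C) hA)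
  exact ⟨p, ⟨hpS, (hpF A₀ hA₀).2⟩, fun A hA => (hpF A hA).1⟩
end

section
/- Let d ≥ 1 and 1 ≤ k ≤ d be integers, let w > 0 be a real number, and let F be a finite family of convex sets in ℝ^d. If the intersection of every subfamily of F with at most 2d members contains an axis-parallel box bx(x,y) for which there is a k-element set V ⊆ {1,…,d} with y_i = x_i for all i ∉ V and ∏_{i ∈ V} (y_i − x_i) ≥ w, then the intersection of all members of F contains an axis-parallel box bx(a,b) for which there is a k-element set U ⊆ {1,…,d} with b_i = a_i for all i ∉ U and ∏_{i ∈ U} (b_i − a_i) ≥ w/C(d,k), where C(d,k) is the binomial coefficient. -/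
open Finset Module

theorem Nat.pow_le_pow_mul_choose {n k : ℕ} (h : k ≤ n) : n ^ k ≤ k ^ k * n.choose k := by
  induction k generalizing n with
  | zero => simp
  | succ k ih =>
    obtain ⟨n, rfl⟩ : ∃ m, n = m + 1 := ⟨n - 1, by omega⟩
    have hkn : k ≤ n := by omega
    have hpow : (n + 1) ^ k ≤ (k + 1) ^ k * n.choose k := by
      rcases Nat.eq_zero_or_pos k with rfl | hk
      · simp
      refine le_of_mul_le_mul_left ?_ (pow_pos hk k)
      calc k ^ k * (n + 1) ^ k = (k * (n + 1)) ^ k := (mul_pow ..).symm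
        _ ≤ ((k + 1) * n) ^ k := Nat.pow_le_pow_left (by nlinarith) k
        _ = (k + 1) ^ k * n ^ k := mul_pow ..
        _ ≤ (k + 1) ^ k * (k ^ k * n.choose k) := Nat.mul_le_mul_left _ (ih hkn)
        _ = k ^ k * ((k + 1) ^ k * n.choose k) := by ring
    calc (n + 1) ^ (k + 1) = (n + 1) ^ k * (n + 1) := pow_succ ..
      _ ≤ (k + 1) ^ k * n.choose k * (n + 1) := Nat.mul_le_mul_right _ hpow
      _ = (k + 1) ^ k * ((n + 1) * n.choose k) := by ring
      _ = (k + 1) ^ (k + 1) * (n + 1).choose (k + 1) := by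
        rw [Nat.add_one_mul_choose_eq]; ring

theorem Finset.card_le_sum_of_one_le_prod {ι : Type*} {s : Finset ι} {f : ι → ℝ}
    (hf : ∀ i ∈ s, 0 ≤ f i) (h : 1 ≤ ∏ i ∈ s, f i) : (#s : ℝ) ≤ ∑ i ∈ s, f i := by
  rcases s.eq_empty_or_nonempty with rfl | hs
  · simp
  have hs' : (0 : ℝ) < #s := by exact_mod_cast hs.card_pos
  have key := Real.geom_mean_le_arith_mean s (fun _ ↦ 1) f (by simp) (by simpa using hs) hf
  simp only [Real.rpow_one, sum_const, nsmul_eq_mul, mul_one, one_mul] at key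
  have := (Real.one_le_rpow h (inv_nonneg.2 hs'.le)).trans key
  rwa [le_div_iff₀ hs', one_mul] at this

theorem Finset.exists_card_eq_forall_notMem_le {ι : Type*} [Fintype ι] (f : ι → ℝ) {k : ℕ}
    (hk : k ≤ Fintype.card ι) : ∃ U : Finset ι, #U = k ∧ ∀ i ∈ U, ∀ j ∉ U, f j ≤ f i := by
  classical
  obtain ⟨U, hU, hmax⟩ := exists_max_image (powersetCard k (univ : Finset ι))
    (fun U ↦ ∑ i ∈ U, f i) (powersetCard_nonempty.2 (by simpa using hk))
  have hUk : #U = k := (mem_powersetCard.1 hU).2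
  refine ⟨U, hUk, fun i hi j hj ↦ ?_⟩
  have hj' : j ∉ U.erase i := fun h ↦ hj (mem_of_mem_erase h)
  have hle := hmax (insert j (U.erase i)) <| mem_powersetCard.2
    ⟨subset_univ _, by rw [card_insert_of_notMem hj', card_erase_add_one hi, hUk]⟩
  simp only [sum_insert hj'] at hle
  linarith [add_sum_erase U f hi]

theorem Finset.prod_max_le_prod {ι : Type*} {U V : Finset ι} {f : ι → ℝ} {m : ℝ} (hm : 0 < m)
    (hcard : #V = #U) (hU : ∀ i ∈ U, m ≤ f i) (hU' : ∀ i ∉ U, f i ≤ m) :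
    ∏ i ∈ V, max (f i) m ≤ ∏ i ∈ U, f i := by
  classical
  have hprod : ∏ i ∈ U, f i = ∏ i ∈ U, max (f i) m :=
    prod_congr rfl fun i hi ↦ (max_eq_left (hU i hi)).symm
  rw [hprod, ← prod_inter_mul_prod_sdiff V U, ← prod_inter_mul_prod_sdiff U V, inter_comm U V]
  refine mul_le_mul_of_nonneg_left ?_ (prod_nonneg fun i _ ↦ hm.le.trans (le_max_right _ _))
  calc ∏ i ∈ V \ U, max (f i) m = ∏ i ∈ V \ U, m :=
        prod_congr rfl fun i hi ↦ max_eq_right (hU' i (mem_sdiff.1 hi).2)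
    _ = ∏ i ∈ U \ V, m := by rw [prod_const, prod_const, card_sdiff_comm hcard]
    _ ≤ ∏ i ∈ U \ V, max (f i) m := prod_le_prod (fun _ _ ↦ hm.le) fun _ _ ↦ le_max_right _ _

/-- The nonnegative vectors supported on `k` coordinates whose product there is at least `w`
lie in this intersection of half-spaces. -/
def boxLengthHull (ι : Type*) [Fintype ι] (k : ℕ) (w : ℝ) : Set (ι → ℝ) :=
  {z | ∀ c : ι → ℝ, (∀ i, 0 ≤ c i) → (∀ V : Finset ι, #V = k → 1 ≤ w * ∏ i ∈ V, c i) →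
    (k : ℝ) ≤ ∑ i, c i * z i}

section boxLengthHull

variable {ι : Type*} [Fintype ι] {k : ℕ} {w : ℝ} {z : ι → ℝ}

theorem convex_boxLengthHull : Convex ℝ (boxLengthHull ι k w) := by
  intro z hz z' hz' a b ha hb hab c hc hV
  have hsum : ∑ i, c i * (a • z + b • z') i = a * ∑ i, c i * z i + b * ∑ i, c i * z' i := by
    rw [mul_sum, mul_sum, ← sum_add_distrib]
    exact sum_congr rfl fun i _ ↦ by simp only [Pi.add_apply, Pi.smul_apply, smul_eq_mul]; ring
  rw [hsum]
  calc (k : ℝ) = a * k + b * k := by rw [← add_mul, hab, one_mul]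
    _ ≤ _ := add_le_add (mul_le_mul_of_nonneg_left (hz c hc hV) ha)
        (mul_le_mul_of_nonneg_left (hz' c hc hV) hb)

theorem mem_boxLengthHull_of_le_prod (hz : 0 ≤ z) {V : Finset ι} (hV : #V = k)
    (hw : w ≤ ∏ i ∈ V, z i) : z ∈ boxLengthHull ι k w := by
  intro c hc hcV
  have hone : 1 ≤ ∏ i ∈ V, c i * z i := by
    rw [prod_mul_distrib, mul_comm]
    exact (hcV V hV).trans (mul_le_mul_of_nonneg_right hw (prod_nonneg fun i _ ↦ hc i))
  calc (k : ℝ) = #V := by rw [hV]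
    _ ≤ ∑ i ∈ V, c i * z i :=
      card_le_sum_of_one_le_prod (fun i _ ↦ mul_nonneg (hc i) (hz i)) hone
    _ ≤ ∑ i, c i * z i :=
      sum_le_sum_of_subset_of_nonneg (subset_univ V) fun i _ _ ↦ mul_nonneg (hc i) (hz i)

theorem boxLengthHull_mono_right {z' : ι → ℝ} (hz : z ∈ boxLengthHull ι k w) (h : z ≤ z') :
    z' ∈ boxLengthHull ι k w := fun c hc hcV ↦
  (hz c hc hcV).trans (sum_le_sum fun i _ ↦ mul_le_mul_of_nonneg_left (h i) (hc i))

theorem mul_pow_le_mul_prod_of_pos_of_mem_boxLengthHull (hk : k ≠ 0) (hw : 0 < w)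
    (hz : z ∈ boxLengthHull ι k w) (hpos : ∀ i, 0 < z i) {U : Finset ι} (hU : #U = k)
    (htop : ∀ i ∈ U, ∀ j ∉ U, z j ≤ z i) :
    w * (k : ℝ) ^ k ≤ (Fintype.card ι : ℝ) ^ k * ∏ i ∈ U, z i := by
  obtain ⟨i₀, hi₀, hmin⟩ := exists_min_image U z (card_pos.1 (by omega))
  set m := z i₀
  set P := ∏ i ∈ U, z i
  have hm : 0 < m := hpos i₀
  have hP : 0 < P := prod_pos fun i _ ↦ hpos i
  have hPw : 0 ≤ P / w := by positivity
  set s := (P / w) ^ ((k : ℝ)⁻¹)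
  have hs : 0 ≤ s := Real.rpow_nonneg hPw _
  have hsk : s ^ k = P / w := Real.rpow_inv_natCast_pow hPw hk
  have hmax (i : ι) : 0 < max (z i) m := lt_max_of_lt_right hm
  have hle := hz (fun i ↦ s / max (z i) m) (fun i ↦ div_nonneg hs (hmax i).le) fun V hV ↦ by
    rw [prod_div_distrib, prod_const, hV, hsk, mul_div_assoc', mul_div_cancel₀ _ hw.ne',
      one_le_div (prod_pos fun i _ ↦ hmax i)]
    exact prod_max_le_prod hm (hV.trans hU.symm) hmin (htop i₀ hi₀)
  have hsum : (k : ℝ) ≤ Fintype.card ι * s := by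
    refine hle.trans ((sum_le_card_nsmul _ _ s fun i _ ↦ ?_).trans_eq (by simp))
    rw [div_mul_eq_mul_div, div_le_iff₀ (hmax i)]
    exact mul_le_mul_of_nonneg_left (le_max_left _ _) hs
  calc w * (k : ℝ) ^ k ≤ w * (Fintype.card ι * s) ^ k := by gcongr
    _ = (Fintype.card ι : ℝ) ^ k * P := by rw [mul_pow, hsk]; field_simp

theorem exists_mul_pow_le_mul_prod_of_mem_boxLengthHull (hk : k ≠ 0) (hkι : k ≤ Fintype.card ι)
    (hw : 0 < w) (hz : z ∈ boxLengthHull ι k w) (hnn : 0 ≤ z) :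
    ∃ U : Finset ι, #U = k ∧ w * (k : ℝ) ^ k ≤ (Fintype.card ι : ℝ) ^ k * ∏ i ∈ U, z i := by
  obtain ⟨U, hU, htop⟩ := exists_card_eq_forall_notMem_le z hkι
  refine ⟨U, hU, ?_⟩
  have hcont : Continuous fun δ : ℝ ↦ (Fintype.card ι : ℝ) ^ k * ∏ i ∈ U, (z i + δ) := by fun_prop
  have hlim := (hcont.tendsto 0).mono_left (nhdsWithin_le_nhds (s := Set.Ioi 0))
  simp only [add_zero] at hlim
  refine ge_of_tendsto hlim (Filter.eventually_of_mem self_mem_nhdsWithin fun δ hδ ↦ ?_)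
  have hδ' : 0 < δ := hδ
  exact mul_pow_le_mul_prod_of_pos_of_mem_boxLengthHull hk hw
    (boxLengthHull_mono_right hz fun i ↦ le_add_of_nonneg_right hδ'.le)
    (fun i ↦ add_pos_of_nonneg_of_pos (hnn i) hδ') hU fun i hi j hj ↦
      add_le_add_left (htop i hi j hj) δ

theorem exists_div_choose_le_prod_of_mem_boxLengthHull (hk : k ≠ 0) (hkι : k ≤ Fintype.card ι)
    (hw : 0 < w) (hz : z ∈ boxLengthHull ι k w) (hnn : 0 ≤ z) :
    ∃ U : Finset ι, #U = k ∧ w / ((Fintype.card ι).choose k : ℝ) ≤ ∏ i ∈ U, z i := by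
  obtain ⟨U, hU, hle⟩ := exists_mul_pow_le_mul_prod_of_mem_boxLengthHull hk hkι hw hz hnn
  refine ⟨U, hU, ?_⟩
  have hkk : (0 : ℝ) < (k : ℝ) ^ k := by positivity
  have hC : (0 : ℝ) < (Fintype.card ι).choose k := by exact_mod_cast Nat.choose_pos hkι
  have hpow : (Fintype.card ι : ℝ) ^ k ≤ (k : ℝ) ^ k * (Fintype.card ι).choose k := by
    exact_mod_cast Nat.pow_le_pow_mul_choose hkι
  rw [div_le_iff₀ hC]
  refine le_of_mul_le_mul_left ?_ hkk
  calc (k : ℝ) ^ k * w = w * (k : ℝ) ^ k := mul_comm ..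
    _ ≤ _ := hle
    _ ≤ (k : ℝ) ^ k * (Fintype.card ι).choose k * ∏ i ∈ U, z i :=
      mul_le_mul_of_nonneg_right hpow (prod_nonneg fun i _ ↦ hnn i)
    _ = _ := by ring

end boxLengthHull

theorem Convex.setOf_Icc_subset {ι : Type*} {A : Set (ι → ℝ)} (hA : Convex ℝ A) :
    Convex ℝ {p : (ι → ℝ) × (ι → ℝ) | p.1 ≤ p.2 ∧ Set.Icc p.1 p.2 ⊆ A} := by
  rintro ⟨x, y⟩ ⟨hxy, hA₁⟩ ⟨x', y'⟩ ⟨hxy', hA₂⟩ a b ha hb hab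
  dsimp only at hxy hxy' hA₁ hA₂
  refine ⟨add_le_add (smul_le_smul_of_nonneg_left hxy ha)
    (smul_le_smul_of_nonneg_left hxy' hb), fun u hu ↦ ?_⟩
  have hseg (i : ι) : ∃ t ∈ Set.Icc (0 : ℝ) 1,
      u i = a * (x i + t * (y i - x i)) + b * (x' i + t * (y' i - x' i)) := by
    have hui : u i ∈ Set.Icc (a * x i + b * x' i) (a * y i + b * y' i) := ⟨hu.1 i, hu.2 i⟩
    rw [← segment_eq_Icc (hui.1.trans hui.2), segment_eq_image'] at hui
    obtain ⟨t, ht, hut⟩ := hui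
    refine ⟨t, ht, ?_⟩
    simp only [← hut, smul_eq_mul]
    ring
  choose t ht hu' using hseg
  have hmem {x y : ι → ℝ} (h : x ≤ y) : (fun i ↦ x i + t i * (y i - x i)) ∈ Set.Icc x y := by
    constructor <;> intro i <;> dsimp only
    · nlinarith [(ht i).1, h i]
    · nlinarith [(ht i).2, h i]
  have hueq : u = a • (fun i ↦ x i + t i * (y i - x i)) +
      b • (fun i ↦ x' i + t i * (y' i - x' i)) := funext hu'
  rw [hueq]
  exact hA (hA₁ (hmem hxy)) (hA₂ (hmem hxy')) ha hb hab

theorem Convex.helly_theorem_with_condition {𝕜 E α : Type*} [Field 𝕜] [LinearOrder 𝕜]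
    [IsStrictOrderedRing 𝕜] [AddCommGroup E] [Module 𝕜 E] [FiniteDimensional 𝕜 E]
    {F : α → Set E} {s : Finset α} {S : Set E} (hF : ∀ i ∈ s, Convex 𝕜 (F i)) (hS : Convex 𝕜 S)
    (hne : (⋂ i ∈ s, F i).Nonempty)
    (hSF : ∀ I ⊆ s, #I ≤ finrank 𝕜 E → (S ∩ ⋂ i ∈ I, F i).Nonempty) :
    (S ∩ ⋂ i ∈ s, F i).Nonempty := by
  classical
  have key := helly_theorem' (𝕜 := 𝕜) (F := fun o : Option α ↦ o.elim S F) (s := insertNone s)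
    (by rintro (_ | i) hi
        · exact hS
        · exact hF i (some_mem_insertNone.1 hi)) fun I hI hcard ↦ by
      have hIs : eraseNone I ⊆ s := fun i hi ↦
        some_mem_insertNone.1 (hI (mem_eraseNone.1 hi))
      by_cases hnone : none ∈ I
      · obtain ⟨p, hpS, hp⟩ := hSF (eraseNone I) hIs (by
          rw [card_eraseNone_of_mem hnone]; omega)
        rw [Set.mem_iInter₂] at hp
        refine ⟨p, Set.mem_iInter₂.2 ?_⟩
        rintro (_ | i) hi
        · exact hpS
        · exact hp i (mem_eraseNone.2 hi)
      · obtain ⟨p, hp⟩ := hne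
        rw [Set.mem_iInter₂] at hp
        refine ⟨p, Set.mem_iInter₂.2 ?_⟩
        rintro (_ | i) hi
        · exact absurd hi hnone
        · exact hp i (hIs (mem_eraseNone.2 hi))
  obtain ⟨p, hp⟩ := key
  rw [Set.mem_iInter₂] at hp
  exact ⟨p, hp none none_mem_insertNone,
    Set.mem_iInter₂.2 fun i hi ↦ hp (some i) (some_mem_insertNone.2 hi)⟩


/-- If every subfamily of at most `2d` members of a finite family of convex sets in `ℝ^d`
has, in its intersection, an axis-parallel box of dimension at most `k` (degenerate
outside a `k`-element set `V` of coordinates) with `k`-dimensional volume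
`∏_{i ∈ V} (yᵢ - xᵢ) ≥ w`, then the intersection of the whole family contains such a box
with `k`-dimensional volume at least `w / C(d,k)`. -/
theorem k_dim_box_helly_volume (d k : ℕ) (hd : 1 ≤ d) (hk1 : 1 ≤ k) (hkd : k ≤ d)
    (w : ℝ) (hw : 0 < w)
    (F : Finset (Set (Fin d → ℝ))) (hconv : ∀ A ∈ F, Convex ℝ A)
    (hloc : ∀ G ⊆ F, G.card ≤ 2 * d →
      ∃ x y : Fin d → ℝ, x ≤ y ∧ (∀ A ∈ G, Set.Icc x y ⊆ A) ∧
        ∃ V : Finset (Fin d), V.card = k ∧ (∀ i ∉ V, y i = x i) ∧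
          w ≤ ∏ i ∈ V, (y i - x i)) :
    ∃ a b : Fin d → ℝ, a ≤ b ∧ (∀ A ∈ F, Set.Icc a b ⊆ A) ∧
      ∃ U : Finset (Fin d), U.card = k ∧ (∀ i ∉ U, b i = a i) ∧
        w / (Nat.choose d k : ℝ) ≤ ∏ i ∈ U, (b i - a i) := by
  classical
  obtain ⟨p, hp⟩ : (⋂ A ∈ F, A).Nonempty :=
    Convex.helly_theorem' (𝕜 := ℝ) (F := id) hconv fun I hI hcard ↦ by
      rw [finrank_fin_fun] at hcard
      obtain ⟨x, y, hxy, hsub, -⟩ := hloc I hI (by omega)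
      exact ⟨x, Set.mem_iInter₂.2 fun A hA ↦ hsub A hA (Set.left_mem_Icc.2 hxy)⟩
  rw [Set.mem_iInter₂] at hp
  let φ : (Fin d → ℝ) × (Fin d → ℝ) →ₗ[ℝ] (Fin d → ℝ) :=
    LinearMap.snd ℝ _ _ - LinearMap.fst ℝ _ _
  have hS : Convex ℝ ({p | p.1 ≤ p.2 ∧ Set.Icc p.1 p.2 ⊆ Set.univ} ∩
      φ ⁻¹' boxLengthHull (Fin d) k w) :=
    convex_univ.setOf_Icc_subset.inter (convex_boxLengthHull.linear_preimage φ)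
  obtain ⟨⟨x, y⟩, ⟨⟨hxy, -⟩, hmem⟩, hF⟩ := Convex.helly_theorem_with_condition (𝕜 := ℝ)
    (F := fun A ↦ {p : (Fin d → ℝ) × (Fin d → ℝ) | p.1 ≤ p.2 ∧ Set.Icc p.1 p.2 ⊆ A}) (s := F)
    (fun A hA ↦ (hconv A hA).setOf_Icc_subset) hS
    ⟨(p, p), Set.mem_iInter₂.2 fun A hA ↦ ⟨le_rfl, by simpa using hp A hA⟩⟩ fun I hI hcard ↦ by
      rw [finrank_prod, finrank_fin_fun] at hcard
      obtain ⟨x, y, hxy, hsub, V, hV, -, hle⟩ := hloc I hI (by omega)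
      exact ⟨(x, y), ⟨⟨hxy, Set.subset_univ _⟩,
        mem_boxLengthHull_of_le_prod (sub_nonneg.2 hxy) hV hle⟩,
        Set.mem_iInter₂.2 fun A hA ↦ ⟨hxy, hsub A hA⟩⟩
  rw [Set.mem_iInter₂] at hF
  dsimp only at hxy
  obtain ⟨U, hU, hle⟩ := exists_div_choose_le_prod_of_mem_boxLengthHull (by omega)
    (by simpa using hkd) hw hmem (sub_nonneg.2 hxy)
  rw [Fintype.card_fin] at hle
  refine ⟨x, U.piecewise y x, le_piecewise_of_le_of_le _ hxy le_rfl, fun A hA ↦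
    (Set.Icc_subset_Icc_right (piecewise_le_of_le_of_le _ le_rfl hxy)).trans (hF A hA).2,
    U, hU, fun i hi ↦ piecewise_eq_of_notMem _ _ _ hi, hle.trans_eq ?_⟩
  exact prod_congr rfl fun i hi ↦ by rw [piecewise_eq_of_mem _ _ _ hi]; rfl
end

section
/- Let a, b ≥ 0 be integers with a + b ≥ 1, set h = (a+1)·2^b, and let F_1, …, F_h be nonempty finite families of convex sets in ℝ^(a+b). If for every choice of sets F_i ∈ F_i (one from each family) the intersection F_1 ∩ ⋯ ∩ F_h contains a point of ℝ^a × ℤ^b, then there is an index k ∈ {1, …, h} such that the intersection of all members of F_k contains a point of ℝ^a × ℤ^b. -/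
open Finset

/-- The cone with apex `p` over `K`, truncated at `K` and with the apex removed. -/
def truncatedCone {E : Type*} [AddCommGroup E] [Module ℝ E] (p : E) (K : Set E) : Set E :=
  {x | ∃ t : ℝ, 0 < t ∧ t ≤ 1 ∧ ∃ k ∈ K, x = (1 - t) • p + t • k}

section TruncatedCone

variable {E : Type*} [AddCommGroup E] [Module ℝ E] {p q : E} {K : Set E}

lemma subset_truncatedCone : K ⊆ truncatedCone p K :=
  fun k hk => ⟨1, one_pos, le_rfl, k, hk, by simp⟩

lemma notMem_truncatedCone (hp : p ∉ K) : p ∉ truncatedCone p K := by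
  rintro ⟨t, ht, -, k, hk, h⟩
  have h0 : t • (k - p) = 0 := by
    have : t • (k - p) = ((1 - t) • p + t • k) - p := by module
    rw [this, ← h, sub_self]
  obtain h1 | h1 := smul_eq_zero.1 h0
  · exact ht.ne' h1
  · exact hp (sub_eq_zero.1 h1 ▸ hk)

lemma Convex.truncatedCone (hK : Convex ℝ K) : Convex ℝ (truncatedCone p K) := by
  rintro _ ⟨s, hs, hs1, k, hk, rfl⟩ _ ⟨t, ht, ht1, l, hl, rfl⟩ α β hα hβ hαβ
  have hpos : 0 < α * s + β * t := by
    obtain h | h := hα.lt_or_eq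
    · have := mul_pos h hs
      have := mul_nonneg hβ ht.le
      linarith
    · have : β = 1 := by linarith
      subst this
      rw [← h]
      linarith
  refine ⟨α * s + β * t, hpos, by nlinarith,
    (α * s / (α * s + β * t)) • k + (β * t / (α * s + β * t)) • l,
    hK hk hl (by positivity) (by positivity) (by field_simp), ?_⟩
  rw [smul_add (α * s + β * t), smul_smul (α * s + β * t), smul_smul (α * s + β * t),
    mul_div_cancel₀ _ hpos.ne', mul_div_cancel₀ _ hpos.ne']
  have : α = 1 - β := by linarith
  subst this
  module

lemma truncatedCone_subset (hK : Convex ℝ K) (hq : q ∈ truncatedCone p K) :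
    truncatedCone q K ⊆ truncatedCone p K := by
  rintro _ ⟨t, ht, ht1, k, hk, rfl⟩
  exact hK.truncatedCone hq (subset_truncatedCone hk) (by linarith) ht.le (by ring)

end TruncatedCone

/-- The real vector with the given integer coordinates. -/
def intVec {b : ℕ} (z : Fin b → ℤ) : Fin b → ℝ := fun i => z i

section Doignon

variable {b : ℕ} {ι : Type*}

lemma exists_modEq_two [Fintype ι] (hcard : 2 ^ b < Fintype.card ι) (p : ι → Fin b → ℤ) :
    ∃ i j, i ≠ j ∧ ∃ m : Fin b → ℤ, p i + p j = 2 • m := by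
  obtain ⟨i, j, hij, h⟩ := Fintype.exists_ne_map_eq_of_card_lt
    (fun (i : ι) (l : Fin b) => ((p i l : ℤ) : ZMod 2)) (by simpa using hcard)
  refine ⟨i, j, hij, fun l => (p i l + p j l) / 2, funext fun l => ?_⟩
  have h1 := (ZMod.intCast_eq_intCast_iff _ _ _).1 (congrFun h l)
  simp only [Pi.add_apply, Pi.smul_apply, nsmul_eq_mul]
  have : p i l % 2 = p j l % 2 := h1
  push_cast
  omega

/-- The critical case of Doignon's theorem: more than `2 ^ b` convex sets in `ℝ^b`, all but any one
of which share a lattice point of `Z`, all share a lattice point of `Z`. -/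
lemma exists_lattice_point_of_forall_ne [Fintype ι] (hcard : 2 ^ b < Fintype.card ι)
    (Z : Finset (Fin b → ℤ)) (hZ : ∀ x ∈ Z, ∀ y ∈ Z, ∀ m, x + y = 2 • m → m ∈ Z)
    (K : ι → Set (Fin b → ℝ)) (hK : ∀ i, Convex ℝ (K i))
    (h : ∀ i, ∃ z ∈ Z, ∀ j, j ≠ i → intVec z ∈ K j) :
    ∃ z ∈ Z, ∀ i, intVec z ∈ K i := by
  classical
  induction hn : ∑ i, #{z ∈ Z | intVec z ∉ K i} using Nat.strong_induction_on generalizing K with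
  | _ n ih =>
  by_contra! hempty
  have hmin (i : ι) : ∃ p ∈ Z, (∀ j, j ≠ i → intVec p ∈ K j) ∧
      ∀ q ∈ Z, (∀ j, j ≠ i → intVec q ∈ K j) → intVec q ∉ truncatedCone (intVec p) (K i) := by
    obtain ⟨p, hp, hpmin⟩ := exists_min_image {z ∈ Z | ∀ j, j ≠ i → intVec z ∈ K j}
      (fun p => #{z ∈ Z | intVec z ∈ truncatedCone (intVec p) (K i)})
      (by obtain ⟨z, hz⟩ := h i; exact ⟨z, by simpa using hz⟩)
    rw [mem_filter] at hp
    refine ⟨p, hp.1, hp.2, fun q hq hqK hqc => ?_⟩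
    have hqi : intVec q ∉ K i := fun hqi => by
      obtain ⟨j, hj⟩ := hempty q hq
      by_cases hji : j = i
      · exact hj (hji ▸ hqi)
      · exact hj (hqK j hji)
    refine (hpmin q (mem_filter.2 ⟨hq, hqK⟩)).not_gt (card_lt_card ?_)
    refine (ssubset_iff_of_subset ?_).2 ⟨q, mem_filter.2 ⟨hq, hqc⟩, ?_⟩
    · exact monotone_filter_right _ fun z _ hz => truncatedCone_subset (hK i) hqc hz
    · simp [notMem_truncatedCone hqi]
  choose p hpZ hpK hpmin using hmin
  obtain ⟨i, j, hij, m, hm⟩ := exists_modEq_two hcard p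
  have hmZ : m ∈ Z := hZ _ (hpZ i) _ (hpZ j) m hm
  have hmv : intVec m = (1 - 1 / 2 : ℝ) • intVec (p i) + (1 / 2 : ℝ) • intVec (p j) := by
    ext l
    have := congrArg (Int.cast : ℤ → ℝ) (congrFun hm l)
    simp only [Pi.add_apply, Pi.smul_apply, nsmul_eq_mul] at this
    push_cast at this
    simp only [intVec, Pi.add_apply, Pi.smul_apply, smul_eq_mul]
    linarith
  have key (l : ι) (hml : intVec m ∈ truncatedCone (intVec (p l)) (K l)) : intVec m ∈ K l := by
    by_contra hmK
    set K' := Function.update K l (truncatedCone (intVec (p l)) (K l)) with hK'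
    have hsub (r : ι) : K r ⊆ K' r := by
      by_cases hr : r = l
      · subst hr; simpa [hK'] using subset_truncatedCone
      · simp [hK', hr]
    have hlt : ∑ r, #{z ∈ Z | intVec z ∉ K' r} < n := by
      rw [← hn]
      have hle (r : ι) : {z ∈ Z | intVec z ∉ K' r} ⊆ {z ∈ Z | intVec z ∉ K r} :=
        monotone_filter_right _ fun z _ hz hzK => hz (hsub r hzK)
      refine sum_lt_sum (fun r _ => card_le_card (hle r)) ⟨l, mem_univ _, card_lt_card ?_⟩
      refine (ssubset_iff_of_subset (hle l)).2 ⟨m, mem_filter.2 ⟨hmZ, hmK⟩, ?_⟩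
      simp [hK', hml]
    obtain ⟨z, hz, hzK⟩ := ih _ hlt K'
      (fun r => by
        by_cases hr : r = l
        · subst hr; simpa [hK'] using (hK r).truncatedCone
        · simpa [hK', hr] using hK r)
      (fun r => ⟨p r, hpZ r, fun s hs => hsub s (hpK r s hs)⟩) rfl
    refine hpmin l z hz (fun r hr => ?_) ?_
    · simpa [hK', hr] using hzK r
    · simpa [hK'] using hzK l
  obtain ⟨l, hl⟩ := hempty m hmZ
  refine hl ?_
  by_cases hli : l = i
  · subst hli
    exact key l ⟨1 / 2, by norm_num, by norm_num, _, hpK j l hij, hmv⟩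
  by_cases hlj : l = j
  · subst hlj
    refine key l ⟨1 / 2, by norm_num, by norm_num, _, hpK i l hij.symm, ?_⟩
    rw [hmv]
    module
  · rw [hmv]
    exact hK l (hpK i l hli) (hpK j l hlj) (by norm_num) (by norm_num) (by norm_num)

/-- **Doignon's theorem**, the Helly theorem for the integer lattice. -/
theorem doignon_theorem {K : ι → Set (Fin b → ℝ)} {s : Finset ι} (hK : ∀ i ∈ s, Convex ℝ (K i))
    (h : ∀ I ⊆ s, #I ≤ 2 ^ b → ∃ z, ∀ i ∈ I, intVec z ∈ K i) :
    ∃ z, ∀ i ∈ s, intVec z ∈ K i := by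
  classical
  induction s using Finset.strongInduction with
  | H s ih =>
  obtain hs | hs := le_or_gt #s (2 ^ b)
  · exact h s subset_rfl hs
  have hp (i : s) : ∃ z, ∀ j ∈ s.erase i, intVec z ∈ K j :=
    ih _ (erase_ssubset i.2) (fun j hj => hK j (mem_of_mem_erase hj))
      (fun I hI => h I (hI.trans (erase_subset _ _)))
  choose p hp using hp
  obtain ⟨lo, hlo⟩ := (univ.image p).bddBelow
  obtain ⟨hi, hhi⟩ := (univ.image p).bddAbove
  obtain ⟨z, -, hz⟩ := exists_lattice_point_of_forall_ne (ι := s) (by simpa using hs) (Icc lo hi)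
    (fun x hx y hy m hm => by
      rw [mem_Icc] at hx hy ⊢
      refine ⟨fun l => ?_, fun l => ?_⟩ <;>
      · have h1 := congrFun hm l
        have h2 := hx.1 l
        have h3 := hx.2 l
        have h4 := hy.1 l
        have h5 := hy.2 l
        simp only [Pi.add_apply, Pi.smul_apply, nsmul_eq_mul] at h1
        push_cast at h1
        lia)
    (fun i => K i) (fun i => hK i i.2)
    (fun i => ⟨p i, mem_Icc.2 ⟨hlo (by simp), hhi (by simp)⟩, fun j hj =>
      hp i j (mem_erase.2 ⟨fun h => hj (Subtype.ext h), j.2⟩)⟩)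
  exact ⟨z, fun i hi => hz ⟨i, hi⟩⟩

end Doignon

/-- The mixed-integer lattice `ℝ^a × ℤ^b`. -/
def mixedLattice (a b : ℕ) : Set (Fin (a + b) → ℝ) :=
  {p | ∀ i : Fin (a + b), a ≤ (i : ℕ) → ∃ m : ℤ, p i = (m : ℝ)}

section MixedLattice

variable {a b : ℕ}

lemma append_intVec_mem_mixedLattice (x : Fin a → ℝ) (z : Fin b → ℤ) :
    Fin.append x (intVec z) ∈ mixedLattice a b := by
  intro i
  refine Fin.addCases (fun j hj => ?_) (fun j _ => ⟨z j, by simp [intVec]⟩) i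
  have := j.2
  simp only [Fin.val_castAdd] at hj
  omega

lemma exists_append_intVec_eq {p : Fin (a + b) → ℝ} (hp : p ∈ mixedLattice a b) :
    ∃ (x : Fin a → ℝ) (z : Fin b → ℤ), Fin.append x (intVec z) = p := by
  choose z hz using fun j : Fin b => hp (Fin.natAdd a j) (by simp)
  refine ⟨fun i => p (Fin.castAdd b i), z, funext fun i => ?_⟩
  refine Fin.addCases (fun j => by simp) (fun j => by simp [intVec, hz]) i

lemma isClosed_mixedLattice : IsClosed (mixedLattice a b) := by
  have : mixedLattice a b = ⋂ (i : Fin (a + b)) (_ : a ≤ (i : ℕ)),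
      (fun p => p i) ⁻¹' Set.range (Int.cast : ℤ → ℝ) := by
    ext p
    simp [mixedLattice, eq_comm]
  rw [this]
  exact isClosed_iInter fun i => isClosed_iInter fun _ =>
    Int.isClosedEmbedding_coe_real.isClosed_range.preimage (continuous_apply i)

lemma smul_append_add_smul_append (α β : ℝ) (x x' : Fin a → ℝ) (y y' : Fin b → ℝ) :
    α • Fin.append x y + β • Fin.append x' y' =
      Fin.append (α • x + β • x') (α • y + β • y') := by
  ext i
  refine Fin.addCases (fun j => by simp) (fun j => by simp) i

/-- The **mixed-integer Helly theorem**. -/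
theorem mixed_integer_helly_theorem {ι : Type*} {K : ι → Set (Fin (a + b) → ℝ)} {s : Finset ι}
    (hK : ∀ i ∈ s, Convex ℝ (K i))
    (h : ∀ I ⊆ s, #I ≤ (a + 1) * 2 ^ b → ∃ p ∈ mixedLattice a b, ∀ i ∈ I, p ∈ K i) :
    ∃ p ∈ mixedLattice a b, ∀ i ∈ s, p ∈ K i := by
  classical
  have hproj : ∃ z : Fin b → ℤ, ∀ I ∈ s.powerset.filter (#· ≤ a + 1),
      intVec z ∈ {y | ∃ x, ∀ i ∈ I, Fin.append x y ∈ K i} := by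
    refine doignon_theorem (fun I hI => ?_) fun J hJ hJcard => ?_
    · rw [mem_filter, mem_powerset] at hI
      rintro y ⟨x, hx⟩ y' ⟨x', hx'⟩ α β hα hβ hαβ
      refine ⟨α • x + β • x', fun i hi => ?_⟩
      rw [← smul_append_add_smul_append]
      exact hK i (hI.1 hi) (hx i hi) (hx' i hi) hα hβ hαβ
    · obtain ⟨p, hp, hpK⟩ := h (J.biUnion id)
        (biUnion_subset.2 fun I hI => mem_powerset.1 (mem_filter.1 (hJ hI)).1)
        ((card_biUnion_le_card_mul _ _ (a + 1) fun I hI => (mem_filter.1 (hJ hI)).2).trans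
          (by rw [mul_comm]; gcongr))
      obtain ⟨x, z, rfl⟩ := exists_append_intVec_eq hp
      exact ⟨z, fun I hI => ⟨x, fun i hi => hpK i (mem_biUnion.2 ⟨I, hI, hi⟩)⟩⟩
  obtain ⟨z, hz⟩ := hproj
  obtain ⟨x, hx⟩ := Convex.helly_theorem' (𝕜 := ℝ) (s := s)
    (F := fun i => {x : Fin a → ℝ | Fin.append x (intVec z) ∈ K i})
    (fun i hi x hx x' hx' α β hα hβ hαβ => by
      have := hK i hi hx hx' hα hβ hαβ
      rwa [smul_append_add_smul_append, ← add_smul, hαβ, one_smul] at this)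
    (fun I hI hcard => by
      obtain ⟨x, hx⟩ := hz I (mem_filter.2 ⟨mem_powerset.2 hI, by simpa using hcard⟩)
      exact ⟨x, by simpa using hx⟩)
  exact ⟨_, append_intVec_mem_mixedLattice x z, by simpa using hx⟩

end MixedLattice

section Lex

variable {n : ℕ}

lemma convex_setOf_toLex_lt (r : Fin n → ℝ) : Convex ℝ {x | toLex x < toLex r} := by
  rintro x ⟨i, hi, hxi⟩ y ⟨j, hj, hyj⟩ α β hα hβ hαβ
  have hr (l : Fin n) : r l = α * r l + β * r l := by rw [← add_mul, hαβ, one_mul]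
  simp only [Pi.toLex_apply] at hi hxi hj hyj
  have hne : α = 0 ∧ β = 1 ∨ β = 0 ∧ α = 1 ∨ 0 < α ∧ 0 < β := by
    obtain h | h := hα.lt_or_eq
    · obtain h' | h' := hβ.lt_or_eq
      · exact Or.inr (Or.inr ⟨h, h'⟩)
      · exact Or.inr (Or.inl ⟨h'.symm, by linarith⟩)
    · exact Or.inl ⟨h.symm, by linarith⟩
  obtain ⟨rfl, rfl⟩ | ⟨rfl, rfl⟩ | ⟨hα', hβ'⟩ := hne
  · simpa using show toLex y < toLex r from ⟨j, hj, hyj⟩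
  · simpa using show toLex x < toLex r from ⟨i, hi, hxi⟩
  refine ⟨min i j, fun l hl => ?_, ?_⟩
  · have hl := lt_min_iff.1 hl
    simp [hi l hl.1, hj l hl.2, ← hr]
  · simp only [Pi.toLex_apply, Pi.add_apply, Pi.smul_apply, smul_eq_mul]
    rw [hr]
    obtain h | h | h := lt_trichotomy i j
    · rw [min_eq_left h.le, hj i h]
      gcongr
    · subst h
      rw [min_self]
      gcongr
    · rw [min_eq_right h.le, hi j h]
      gcongr

lemma IsCompact.exists_forall_toLex_le {M : Set (Fin n → ℝ)} (hM : IsCompact M)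
    (hne : M.Nonempty) : ∃ x ∈ M, ∀ y ∈ M, toLex x ≤ toLex y := by
  have hstep (k : ℕ) (hk : k ≤ n) : ∃ K ⊆ M, IsCompact K ∧ K.Nonempty ∧ ∀ x ∈ K, ∀ y ∈ M,
      (y ∈ K ∧ ∀ j : Fin n, (j : ℕ) < k → x j = y j) ∨ toLex x < toLex y := by
    induction k with
    | zero => exact ⟨M, subset_rfl, hM, hne, fun x _ y hy => Or.inl ⟨hy, by simp⟩⟩
    | succ k ih =>
      obtain ⟨K, hKM, hK, hKne, hKlex⟩ := ih (by omega)
      let k' : Fin n := ⟨k, hk⟩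
      obtain ⟨x₀, hx₀, hmin⟩ := hK.exists_isMinOn hKne (continuous_apply k').continuousOn
      refine ⟨K ∩ {x | x k' = x₀ k'}, Set.inter_subset_left.trans hKM,
        hK.inter_right (isClosed_eq (continuous_apply k') continuous_const), ⟨x₀, hx₀, rfl⟩, ?_⟩
      rintro x ⟨hx, hxk⟩ y hy
      obtain ⟨hyK, hxy⟩ | hlt := hKlex x hx y hy
      · obtain hlt | heq := (isMinOn_iff.1 hmin y hyK).lt_or_eq
        · exact Or.inr ⟨k', fun j hj => hxy j hj, hxk.trans_lt hlt⟩
        · refine Or.inl ⟨⟨hyK, heq.symm⟩, fun j hj => ?_⟩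
          obtain hj | hj := Nat.lt_succ_iff_lt_or_eq.1 hj
          · exact hxy j hj
          · obtain rfl : j = k' := Fin.ext hj
            exact hxk.trans heq
      · exact Or.inr hlt
  obtain ⟨K, hKM, -, ⟨x, hx⟩, hlex⟩ := hstep n le_rfl
  refine ⟨x, hKM hx, fun y hy => ?_⟩
  obtain ⟨-, h⟩ | h := hlex x hx y hy
  · exact (congrArg toLex (funext fun j => h j j.2)).le
  · exact h.le

end Lex

/-- The mixed-integer Helly theorem, colorful version for families of compact convex sets. -/
theorem colorful_mixed_integer_helly_of_isCompact {a b : ℕ} {ι α : Type*} [Fintype ι] [Nontrivial ι]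
    (hcard : Fintype.card ι = (a + 1) * 2 ^ b) (F : ι → Finset α) (hne : ∀ i, (F i).Nonempty)
    (K : ι → α → Set (Fin (a + b) → ℝ)) (hconv : ∀ i, ∀ A ∈ F i, Convex ℝ (K i A))
    (hcomp : ∀ i, ∀ A ∈ F i, IsCompact (K i A))
    (hloc : ∀ c : ι → α, (∀ i, c i ∈ F i) → ∃ p ∈ mixedLattice a b, ∀ i, p ∈ K i (c i)) :
    ∃ k, ∃ p ∈ mixedLattice a b, ∀ A ∈ F k, p ∈ K k A := by
  classical
  have hmin (I : Set ι) (hI : I.Nonempty) (c : ι → α) (hc : ∀ i, c i ∈ F i) :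
      ∃ x ∈ mixedLattice a b ∩ ⋂ i ∈ I, K i (c i),
        ∀ y ∈ mixedLattice a b ∩ ⋂ i ∈ I, K i (c i), toLex x ≤ toLex y := by
    refine IsCompact.exists_forall_toLex_le ?_ ?_
    · obtain ⟨j, hj⟩ := hI
      refine (hcomp j _ (hc j)).of_isClosed_subset (isClosed_mixedLattice.inter
        (isClosed_biInter fun i _ => (hcomp i _ (hc i)).isClosed)) ?_
      exact Set.inter_subset_right.trans (Set.biInter_subset_of_mem hj)
    · obtain ⟨p, hp, hpK⟩ := hloc c hc
      exact ⟨p, hp, Set.mem_iInter₂.2 fun i _ => hpK i⟩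
  have hdrop (k : ι) (c : ι → α) : ∃ x : Fin (a + b) → ℝ, (∀ i, c i ∈ F i) →
      (x ∈ mixedLattice a b ∧ ∀ i, i ≠ k → x ∈ K i (c i)) ∧
        ∀ y ∈ mixedLattice a b, (∀ i, i ≠ k → y ∈ K i (c i)) → toLex x ≤ toLex y := by
    by_cases hc : ∀ i, c i ∈ F i
    · obtain ⟨x, hx, hx'⟩ := hmin {k}ᶜ (exists_ne k) c hc
      exact ⟨x, fun _ => ⟨by simpa using hx, by simpa using hx'⟩⟩
    · exact ⟨0, fun h => absurd h hc⟩
  choose x hx using hdrop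
  obtain ⟨⟨k, c⟩, hkc, hmax⟩ := exists_max_image ((univ : Finset ι) ×ˢ Fintype.piFinset F)
    (fun kc => toLex (x kc.1 kc.2))
    (univ_nonempty.product (Fintype.piFinset_nonempty.2 hne))
  have hc : ∀ i, c i ∈ F i := by simpa using hkc
  refine ⟨k, x k c, (hx k c hc).1.1, fun A hA => ?_⟩
  set c' := Function.update c k A
  have hc'_ne (i : ι) (hi : i ≠ k) : c' i = c i := Function.update_of_ne hi _ _
  have hc'_self : c' k = A := Function.update_self _ _ _
  have hc' (i : ι) : c' i ∈ F i := by
    by_cases hi : i = k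
    · subst hi; rwa [hc'_self]
    · rw [hc'_ne i hi]; exact hc i
  obtain ⟨y, hy, hymin⟩ := hmin Set.univ Set.univ_nonempty c' hc'
  simp only [Set.mem_inter_iff, Set.mem_iInter, Set.mem_univ, true_imp_iff] at hy hymin
  have hxy : toLex (x k c) ≤ toLex y :=
    (hx k c hc).2 y hy.1 fun i hi => hc'_ne i hi ▸ hy.2 i
  have hyx : ∃ k', toLex y ≤ toLex (x k' c') := by
    by_contra! hlt
    obtain ⟨p, hp, hpK⟩ := mixed_integer_helly_theorem (s := univ)
      (K := fun o : Option ι => o.elim {p | toLex p < toLex y} fun i => K i (c' i))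
      (fun o _ => by
        cases o with
        | none => exact convex_setOf_toLex_lt y
        | some i => exact hconv i _ (hc' i))
      (fun I _ hI => by
        obtain ⟨o, ho⟩ : ∃ o, o ∉ I := by
          by_contra! hall
          rw [eq_univ_of_forall hall, card_univ, Fintype.card_option] at hI
          omega
        cases o with
        | none =>
          refine ⟨y, hy.1, fun o ho' => ?_⟩
          cases o with
          | none => exact absurd ho' ho
          | some i => exact hy.2 i
        | some k' =>
          refine ⟨x k' c', (hx k' c' hc').1.1, fun o ho' => ?_⟩
          cases o with
          | none => exact hlt k'
          | some i => exact (hx k' c' hc').1.2 i fun h => ho (h ▸ ho'))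
    exact (hymin p ⟨hp, fun i => hpK (some i) (mem_univ _)⟩).not_gt (hpK none (mem_univ _))
  obtain ⟨k', hk'⟩ := hyx
  have hle := hmax (k', c') (by simpa using hc')
  have heq : x k c = y := toLex.injective (hxy.antisymm (hk'.trans hle))
  rw [heq, ← hc'_self]
  exact hy.2 k


/-- Colorful mixed-integer Helly theorem: with `h = (a+1)·2^b` color classes of convex
sets in `ℝ^(a+b)`, if every colorful selection has a point of the mixed-integer lattice
`ℝ^a × ℤ^b` (points whose last `b` coordinates are integers) in its intersection, then
some color class does as well. -/
theorem colorful_mixed_integer_helly (a b : ℕ) (hab : 1 ≤ a + b)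
    (F : Fin ((a + 1) * 2 ^ b) → Finset (Set (Fin (a + b) → ℝ)))
    (hne : ∀ i, (F i).Nonempty)
    (hconv : ∀ i, ∀ A ∈ F i, Convex ℝ A)
    (hloc : ∀ c : Fin ((a + 1) * 2 ^ b) → Set (Fin (a + b) → ℝ), (∀ i, c i ∈ F i) →
      ∃ p : Fin (a + b) → ℝ,
        (∀ i : Fin (a + b), a ≤ (i : ℕ) → ∃ m : ℤ, p i = (m : ℝ)) ∧ ∀ i, p ∈ c i) :
    ∃ k : Fin ((a + 1) * 2 ^ b), ∃ p : Fin (a + b) → ℝ,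
      (∀ i : Fin (a + b), a ≤ (i : ℕ) → ∃ m : ℤ, p i = (m : ℝ)) ∧ ∀ A ∈ F k, p ∈ A := by
  classical
  have hcard : 1 < Fintype.card (Fin ((a + 1) * 2 ^ b)) := by
    rw [Fintype.card_fin]
    obtain rfl | hb := Nat.eq_zero_or_pos b
    · omega
    · exact (Nat.one_lt_two_pow hb.ne').trans_le (Nat.le_mul_of_pos_left _ a.succ_pos)
  have : Nontrivial (Fin ((a + 1) * 2 ^ b)) := Fintype.one_lt_card_iff_nontrivial.1 hcard
  have hloc' (c : Fin ((a + 1) * 2 ^ b) → Set (Fin (a + b) → ℝ)) :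
      ∃ p : Fin (a + b) → ℝ, (∀ i, c i ∈ F i) → p ∈ mixedLattice a b ∧ ∀ i, p ∈ c i := by
    by_cases hc : ∀ i, c i ∈ F i
    · obtain ⟨p, hp⟩ := hloc c hc
      exact ⟨p, fun _ => hp⟩
    · exact ⟨0, fun h => absurd h hc⟩
  choose P hP using hloc'
  let V (i : Fin ((a + 1) * 2 ^ b)) (A : Set (Fin (a + b) → ℝ)) : Set (Fin (a + b) → ℝ) :=
    P '' {c | c ∈ Fintype.piFinset F ∧ c i = A}
  have hVA (i A) : convexHull ℝ (V i A) ⊆ convexHull ℝ A := by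
    refine convexHull_mono ?_
    rintro _ ⟨c, ⟨hc, rfl⟩, rfl⟩
    exact (hP c (Fintype.mem_piFinset.1 hc)).2 i
  obtain ⟨k, p, hp, hpK⟩ := colorful_mixed_integer_helly_of_isCompact (Fintype.card_fin _) F hne
    (fun i A => convexHull ℝ (V i A)) (fun _ _ _ => convex_convexHull ℝ _)
    (fun i A _ => (((Fintype.piFinset F).finite_toSet.subset fun _ hc => hc.1).image
      P).isCompact_convexHull ℝ)
    (fun c hc => ⟨P c, (hP c hc).1, fun i =>
      subset_convexHull ℝ _ ⟨c, ⟨Fintype.mem_piFinset.2 hc, rfl⟩, rfl⟩⟩)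
  refine ⟨k, p, hp, fun A hA => ?_⟩
  rw [← (hconv k A hA).convexHull_eq]
  exact hVA k A (hpK A hA)
end

section
/- Let a : ℤ → ℝ be a strictly increasing function whose image A = {a(n) : n ∈ ℤ} is a discrete subset of ℝ, and define t(n) = (a(n+2) − a(n+1)) / (a(n+1) − a(n)) for n ∈ ℤ. Suppose there exist b ∈ ℤ and m ∈ ℕ such that t(n) ≥ t(n+1) for every b ≤ n ≤ b+m−1, with strict inequality t(n) > t(n+1) holding for at least k values of n in this range. Then k + 3 is not a Helly bound for A × A ⊆ ℝ²; that is, there exists a finite family F of convex sets in ℝ² such that the intersection of every subfamily of at most k + 3 members of F contains a point of A × A, but the intersection of all members of F contains no point of A × A. (In other words, H(A²) ≥ k + 4.) -/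
/-- To refute a Helly bound it suffices to give more than `h` convex sets without a common
point in `S`, each of which is missed by exactly one of some associated points of `S`. -/
theorem not_hellyBound_of_witnesses {N : ℕ} {S : Set (Fin N → ℝ)} {h : ℕ} {ι : Type*}
    (I : Finset ι) (hI : h < I.card) (C : ι → Set (Fin N → ℝ)) (p : ι → Fin N → ℝ)
    (hC : ∀ i ∈ I, Convex ℝ (C i)) (hp : ∀ i ∈ I, p i ∈ S)
    (hmem : ∀ i ∈ I, ∀ j ∈ I, i ≠ j → p i ∈ C j) (hnot : ∀ i ∈ I, p i ∉ C i)
    (hempty : ∀ q ∈ S, ∃ i ∈ I, q ∉ C i) : ¬ HellyBound N S h := by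
  classical
  intro H
  have hinj : Set.InjOn C I := by
    intro i hi j hj hij
    by_contra hne
    exact hnot i hi (hij ▸ hmem i hi j hj hne)
  obtain ⟨q, hqS, hq⟩ := H (I.image C) (by simpa using hC) (by
    intro G hG hcard
    have hlt : G.card < (I.image C).card := by
      rw [Finset.card_image_of_injOn hinj]
      exact hcard.trans_lt hI
    obtain ⟨A, hA, hAG⟩ := Finset.exists_mem_notMem_of_card_lt_card hlt
    obtain ⟨i, hi, rfl⟩ := Finset.mem_image.1 hA
    refine ⟨p i, hp i hi, fun B hB => ?_⟩
    obtain ⟨j, hj, rfl⟩ := Finset.mem_image.1 (hG hB)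
    exact hmem i hi j hj fun hij => hAG (hij ▸ hB))
  obtain ⟨i, hi, hqi⟩ := hempty q hqS
  exact hqi (hq _ (Finset.mem_image_of_mem C hi))

/-- An open half-space together with a convex part of its boundary hyperplane is convex. -/
theorem convex_halfSpace_union_boundary {E : Type*} [AddCommGroup E] [Module ℝ E]
    (f g : E →ₗ[ℝ] ℝ) (c : ℝ) {T : Set ℝ} (hT : Convex ℝ T) :
    Convex ℝ {p : E | f p < c ∨ f p = c ∧ g p ∈ T} := by
  rw [convex_iff_forall_pos]
  intro x hx y hy α β hα hβ hαβ
  simp only [Set.mem_ofPred_eq, map_add, map_smul, smul_eq_mul] at hx hy ⊢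
  have hc : α * c + β * c = c := by rw [← add_mul, hαβ, one_mul]
  rcases hx with hx | ⟨hx, hx'⟩
  · left
    have hy' : f y ≤ c := hy.elim le_of_lt fun h => h.1.le
    nlinarith [mul_lt_mul_of_pos_left hx hα, mul_le_mul_of_nonneg_left hy' hβ.le]
  · rcases hy with hy | ⟨hy, hy'⟩
    · left
      rw [hx]
      nlinarith [mul_lt_mul_of_pos_left hy hβ]
    · right
      refine ⟨by rw [hx, hy, hc], ?_⟩
      simpa using hT hx' hy' hα.le hβ.le hαβ

section Chain

variable {a t : ℤ → ℝ} {b e : ℤ}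

theorem antitone_on_of_step (hdec : ∀ n, b ≤ n → n + 1 < e → t (n + 1) ≤ t n)
    {i j : ℤ} (hi : b ≤ i) (hij : i ≤ j) (hj : j < e) : t j ≤ t i := by
  induction j, hij using Int.leInduction with
  | base => exact le_rfl
  | succ j hij ih => exact (hdec j (by lia) hj).trans (ih (by lia))

theorem chain_below_line_left (ha : StrictMono a)
    (ht : ∀ n, t n * (a (n + 1) - a n) = a (n + 2) - a (n + 1))
    (hdec : ∀ n, b ≤ n → n + 1 < e → t (n + 1) ≤ t n)
    {n j : ℤ} (hn : b ≤ n) (hnj : n ≤ j) (hj : j ≤ e) :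
    a (n + 1) ≤ a (j + 1) + t (j - 1) * (a n - a j) := by
  induction n, hnj using Int.leInductionDown with
  | base => simp
  | pred n hnj ih =>
    have h1 := ih (by lia)
    have h2 := antitone_on_of_step hdec hn (j := j - 1) (by lia) (by lia)
    have h3 := ht (n - 1)
    have h4 : a (n - 1) < a n := ha (by lia)
    rw [show n - 1 + 2 = n + 1 by ring, sub_add_cancel] at h3
    rw [sub_add_cancel]
    nlinarith [mul_le_mul_of_nonneg_right h2 (sub_pos.2 h4).le]

theorem chain_eq_line_left
    (ht : ∀ n, t n * (a (n + 1) - a n) = a (n + 2) - a (n + 1))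
    {n j : ℤ} (hnj : n ≤ j) (hconst : ∀ i, n ≤ i → i < j → t i = t (i - 1)) :
    a (n + 1) = a (j + 1) + t (j - 1) * (a n - a j) := by
  induction j, hnj using Int.leInduction with
  | base => simp
  | succ j hnj ih =>
    have h1 := ih fun i hi hij => hconst i hi (by lia)
    have h2 := hconst j hnj (by lia)
    have h3 := ht j
    rw [add_sub_cancel_right, show j + 1 + 1 = j + 2 by ring]
    rw [← h2] at h1
    linarith

theorem chain_lt_line_right (ha : StrictMono a)
    (ht : ∀ n, t n * (a (n + 1) - a n) = a (n + 2) - a (n + 1))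
    (hdec : ∀ n, b ≤ n → n + 1 < e → t (n + 1) ≤ t n)
    {n j : ℤ} (hj : b ≤ j) (hlt : t j < t (j - 1)) (hjn : j < n) (hn : n ≤ e) :
    a (n + 1) < a (j + 1) + t (j - 1) * (a n - a j) := by
  induction n, (show j + 1 ≤ n from hjn) using Int.leInduction with
  | base =>
    have h3 := ht j
    have h4 : a j < a (j + 1) := ha (by lia)
    rw [show j + 1 + 1 = j + 2 by ring]
    nlinarith [mul_lt_mul_of_pos_right hlt (sub_pos.2 h4)]
  | succ n hjn' ih =>
    have h1 := ih (by lia) (by lia)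
    have h2 := antitone_on_of_step hdec hj (j := n) (by lia) (by lia)
    have h3 := ht n
    have h4 : a n < a (n + 1) := ha (by lia)
    rw [show n + 1 + 1 = n + 2 by ring]
    nlinarith [mul_le_mul_of_nonneg_right (h2.trans hlt.le) (sub_pos.2 h4).le]

/-- The points `(a n, a (n + 1))` with `n = b` or `n ∈ J`, together with `(a b, a b)` and
`(a e, a e)`, are the vertices of a convex polygon without interior points of the grid. -/
theorem not_hellyBound_of_concave_chain (ha : StrictMono a)
    (ht : ∀ n, t n * (a (n + 1) - a n) = a (n + 2) - a (n + 1))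
    (hdec : ∀ n, b ≤ n → n + 1 < e → t (n + 1) ≤ t n)
    {J : Finset ℤ} (hJ : ∀ j, j ∈ J ↔ b < j ∧ j ≤ e ∧ (j < e → t j < t (j - 1)))
    (hbe : b < e) {h : ℕ} (hh : h < J.card + 3) :
    ¬ HellyBound 2 {z : Fin 2 → ℝ | z 0 ∈ Set.range a ∧ z 1 ∈ Set.range a} h := by
  let X : (Fin 2 → ℝ) →ₗ[ℝ] ℝ := LinearMap.proj 0
  let Y : (Fin 2 → ℝ) →ₗ[ℝ] ℝ := LinearMap.proj 1
  let T : ℤ → Set ℝ := fun j => {x | ∃ i, (i = b ∨ i ∈ J) ∧ i < j ∧ x ≤ a i}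
  have hT : ∀ j, Convex ℝ (T j) := fun j =>
    Set.OrdConnected.convex ⟨fun _ _ _ ⟨i, hi, hij, hx⟩ _ hz => ⟨i, hi, hij, hz.2.trans hx⟩⟩
  let top : ℤ → Set (Fin 2 → ℝ) := fun j =>
    {z | (Y - t (j - 1) • X) z < a (j + 1) - t (j - 1) * a j ∨
      (Y - t (j - 1) • X) z = a (j + 1) - t (j - 1) * a j ∧ X z ∈ T j}
  let left : Set (Fin 2 → ℝ) := {z | (-X) z < -a b ∨ (-X) z = -a b ∧ Y z ∈ Set.Iic (a b)}
  let right : Set (Fin 2 → ℝ) := {z | X z < a e ∨ X z = a e ∧ Y z ∈ Set.Ici (a (e + 1))}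
  let bottom : Set (Fin 2 → ℝ) := {z | (X - Y) z < 0 ∨ (X - Y) z = 0 ∧ X z ∈ Set.Ici (a e)}
  have mem_top : ∀ j x y, ![x, y] ∈ top j ↔ y < a (j + 1) + t (j - 1) * (x - a j) ∨
      y = a (j + 1) + t (j - 1) * (x - a j) ∧ ∃ i, (i = b ∨ i ∈ J) ∧ i < j ∧ x ≤ a i := by
    intro j x y
    simp only [top, T, X, Y, Set.mem_ofPred_eq, LinearMap.sub_apply, LinearMap.smul_apply,
      LinearMap.proj_apply, Matrix.cons_val_zero, Matrix.cons_val_one, smul_eq_mul]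
    refine or_congr ?_ (and_congr_left' ?_)
    · constructor <;> intro h <;> linarith
    · constructor <;> intro h <;> linarith
  have mem_left : ∀ x y, ![x, y] ∈ left ↔ a b < x ∨ x = a b ∧ y ≤ a b := by
    intro x y; simp [left, X, Y]
  have mem_right : ∀ x y, ![x, y] ∈ right ↔ x < a e ∨ x = a e ∧ a (e + 1) ≤ y := by
    intro x y; simp [right, X, Y]
  have mem_bottom : ∀ x y, ![x, y] ∈ bottom ↔ x < y ∨ x = y ∧ a e ≤ x := by
    intro x y; simp [bottom, X, Y, sub_eq_zero]
  have succ_lt : ∀ n, a n < a (n + 1) := fun n => ha (by lia)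
  have heJ : e ∈ J := (hJ e).2 ⟨hbe, le_rfl, fun h => absurd h (lt_irrefl e)⟩
  have chain_mem_top : ∀ n, (n = b ∨ n ∈ J) → ∀ j ∈ J, n ≠ j → ![a n, a (n + 1)] ∈ top j := by
    intro n hn j hj hne
    obtain ⟨hbj, hje, hjlt⟩ := (hJ j).1 hj
    have hbn : b ≤ n ∧ n ≤ e := by
      rcases hn with rfl | hn
      · exact ⟨le_rfl, hbe.le⟩
      · exact ⟨((hJ n).1 hn).1.le, ((hJ n).1 hn).2.1⟩
    rw [mem_top]
    rcases hne.lt_or_gt with hnj | hjn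
    · rcases (chain_below_line_left ha ht hdec hbn.1 hnj.le hje).lt_or_eq with hlt | heq
      · exact Or.inl hlt
      · exact Or.inr ⟨heq, n, hn, hnj, le_rfl⟩
    · exact Or.inl (chain_lt_line_right ha ht hdec hbj.le (hjlt (by lia)) hjn hbn.2)
  have b_corner_mem_top : ∀ j ∈ J, ![a b, a b] ∈ top j := by
    intro j hj
    rw [mem_top]
    left
    obtain ⟨hbj, hje, -⟩ := (hJ j).1 hj
    exact (succ_lt b).trans_le (chain_below_line_left ha ht hdec le_rfl hbj.le hje)
  have e_corner_mem_top : ∀ j ∈ J, ![a e, a e] ∈ top j := by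
    intro j hj
    rw [mem_top]
    left
    obtain ⟨hbj, hje, hjlt⟩ := (hJ j).1 hj
    rcases hje.lt_or_eq with hlt | rfl
    · exact (succ_lt e).trans (chain_lt_line_right ha ht hdec hbj.le (hjlt hlt) hlt le_rfl)
    · simpa using succ_lt j
  have habe : a b < a e := ha hbe
  refine not_hellyBound_of_witnesses (J.disjSum (Finset.univ : Finset (Fin 3)))
    (by simpa using hh) (Sum.elim top ![left, right, bottom])
    (Sum.elim (fun n => ![a n, a (n + 1)]) ![![a b, a (b + 1)], ![a e, a e], ![a b, a b]])
    ?_ ?_ ?_ ?_ ?_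
  · rintro (j | j) -
    · exact convex_halfSpace_union_boundary _ _ _ (hT j)
    · fin_cases j
      · exact convex_halfSpace_union_boundary _ _ _ (convex_Iic _)
      · exact convex_halfSpace_union_boundary _ _ _ (convex_Ici _)
      · exact convex_halfSpace_union_boundary _ _ _ (convex_Ici _)
  · rintro (j | j) -
    · simp
    · fin_cases j <;> simp
  · rintro (i | i) hi (j | j) hj hij
    · exact chain_mem_top i (.inr (by simpa using hi)) j (by simpa using hj) (by simpa using hij)
    · obtain ⟨hbi, hie, -⟩ := (hJ i).1 (by simpa using hi)
      fin_cases j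
      · exact (mem_left _ _).2 (.inl (ha hbi))
      · refine (mem_right _ _).2 ?_
        rcases hie.lt_or_eq with h | rfl
        · exact .inl (ha h)
        · exact .inr ⟨rfl, le_rfl⟩
      · exact (mem_bottom _ _).2 (.inl (succ_lt i))
    · have hj' : j ∈ J := by simpa using hj
      fin_cases i
      · exact chain_mem_top b (.inl rfl) j hj' ((hJ j).1 hj').1.ne
      · exact e_corner_mem_top j hj'
      · exact b_corner_mem_top j hj'
    · fin_cases i <;> fin_cases j
      · exact absurd rfl hij
      · exact (mem_right _ _).2 (.inl habe)
      · exact (mem_bottom _ _).2 (.inl (succ_lt b))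
      · exact (mem_left _ _).2 (.inl habe)
      · exact absurd rfl hij
      · exact (mem_bottom _ _).2 (.inr ⟨rfl, le_rfl⟩)
      · exact (mem_left _ _).2 (.inr ⟨rfl, le_rfl⟩)
      · exact (mem_right _ _).2 (.inl habe)
      · exact absurd rfl hij
  · rintro (i | i) hi
    · intro hmem
      rcases (mem_top _ _ _).1 hmem with h | ⟨-, l, -, hl, hle⟩
      · simp at h
      · exact (ha hl).not_ge hle
    · fin_cases i
      · intro hmem
        rcases (mem_left _ _).1 hmem with h | ⟨-, h⟩
        · exact lt_irrefl _ h
        · exact h.not_gt (succ_lt b)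
      · intro hmem
        rcases (mem_right _ _).1 hmem with h | ⟨-, h⟩
        · exact lt_irrefl _ h
        · exact h.not_gt (succ_lt e)
      · intro hmem
        rcases (mem_bottom _ _).1 hmem with h | ⟨-, h⟩
        · exact lt_irrefl _ h
        · exact h.not_gt habe
  · rintro q ⟨⟨u, hu⟩, ⟨w, hw⟩⟩
    by_contra! hall
    have hq : q = ![a u, a w] := by
      ext i
      fin_cases i
      · exact hu.symm
      · exact hw.symm
    subst hq
    have hleft := (mem_left _ _).1 (hall (.inr 0) (by simp))
    have hright := (mem_right _ _).1 (hall (.inr 1) (by simp))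
    have hbottom := (mem_bottom _ _).1 (hall (.inr 2) (by simp))
    simp only [ha.lt_iff_lt, ha.le_iff_le, ha.injective.eq_iff] at hleft hright hbottom
    obtain ⟨hbu, hue, huw⟩ : b < u ∧ u ≤ e ∧ u + 1 ≤ w := by lia
    have hne : {j ∈ J | u ≤ j}.Nonempty := ⟨e, by simp [heJ, hue]⟩
    obtain ⟨j, hj, hmin⟩ := Finset.exists_min_image _ id hne
    simp only [Finset.mem_filter, id_eq, and_imp] at hj hmin
    obtain ⟨hbj, hje, -⟩ := (hJ j).1 hj.1
    have hline : a (u + 1) = a (j + 1) + t (j - 1) * (a u - a j) := by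
      refine chain_eq_line_left ht hj.2 fun i hui hij => ?_
      have hi : i ∉ J := fun hi => (hmin i hi hui).not_gt hij
      have h1 : ¬ t i < t (i - 1) := fun h => hi ((hJ i).2 ⟨by lia, by lia, fun _ => h⟩)
      have h2 := antitone_on_of_step hdec (i := i - 1) (j := i) (by lia) (by lia) (by lia)
      exact le_antisymm h2 (not_lt.1 h1)
    rcases (mem_top _ _ _).1 (hall (.inl j) (by simpa using hj.1)) with h | ⟨-, i, hi, hij, hle⟩
    · rw [← hline] at h
      exact h.not_ge (ha.monotone huw)
    · have hui := ha.le_iff_le.1 hle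
      rcases hi with rfl | hi
      · lia
      · exact (hmin i hi hui).not_gt hij

end Chain

/-- Lower bound for Helly numbers of planar product sets: if `a : ℤ → ℝ` strictly
increasingly enumerates a discrete set `A ⊆ ℝ` and the quotients
`t(n) = (a(n+2) - a(n+1)) / (a(n+1) - a(n))` satisfy `t(n) ≥ t(n+1)` for
`b ≤ n ≤ b+m-1` with strict inequality at least `k` times in this range, then
`H(A²) ≥ k + 4`, i.e. `k + 3` is not a Helly bound for `A × A ⊆ ℝ²`. -/
theorem product_set_helly_lower_bound (a : ℤ → ℝ) (hmono : StrictMono a)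
    (hdisc : ∀ x : ℝ, ¬ AccPt x (Filter.principal (Set.range a)))
    (b : ℤ) (m k : ℕ)
    (hdec : ∀ n : ℤ, b ≤ n → n ≤ b + (m : ℤ) - 1 →
      (a (n + 3) - a (n + 2)) / (a (n + 2) - a (n + 1)) ≤
        (a (n + 2) - a (n + 1)) / (a (n + 1) - a n))
    (hstrict : k ≤ ({n : ℤ | b ≤ n ∧ n ≤ b + (m : ℤ) - 1 ∧
      (a (n + 3) - a (n + 2)) / (a (n + 2) - a (n + 1)) <
        (a (n + 2) - a (n + 1)) / (a (n + 1) - a n)}).ncard) :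
    ¬ HellyBound 2 {z : Fin 2 → ℝ | z 0 ∈ Set.range a ∧ z 1 ∈ Set.range a} (k + 3) := by
  classical
  let t : ℤ → ℝ := fun n => (a (n + 2) - a (n + 1)) / (a (n + 1) - a n)
  have ht : ∀ n, t n * (a (n + 1) - a n) = a (n + 2) - a (n + 1) := fun n =>
    div_mul_cancel₀ _ (sub_pos.2 (hmono (by lia))).ne'
  have ht_succ : ∀ n, t (n + 1) = (a (n + 3) - a (n + 2)) / (a (n + 2) - a (n + 1)) := by
    intro n
    simp only [t, add_assoc]
    norm_num
  let K : Finset ℤ := {n ∈ Finset.Icc b (b + m - 1) | t (n + 1) < t n}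
  have hK : k ≤ K.card := by
    rw [← Set.ncard_coe_finset]
    convert hstrict using 2
    ext n
    simp only [K, Finset.coe_filter, Finset.mem_Icc, Set.mem_ofPred_eq, ht_succ, and_assoc]
    rfl
  let J : Finset ℤ := insert (b + m + 1) (K.image (· + 1))
  have hJcard : J.card = K.card + 1 := by
    rw [Finset.card_insert_of_notMem, Finset.card_image_of_injective _ (add_left_injective 1)]
    simp [K]
  refine not_hellyBound_of_concave_chain (t := t) (b := b) (e := b + m + 1) (J := J) hmono ht
    (fun n hb hn => ?_) (fun j => ?_) (by lia) (by lia)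
  · rw [ht_succ]
    exact hdec n hb (by lia)
  · simp only [J, K, Finset.mem_insert, Finset.mem_image, Finset.mem_filter, Finset.mem_Icc]
    constructor
    · rintro (rfl | ⟨n, ⟨hn, hlt⟩, rfl⟩)
      · exact ⟨by lia, le_rfl, fun h => absurd h (lt_irrefl _)⟩
      · exact ⟨by lia, by lia, fun _ => by rwa [add_sub_cancel_right]⟩
    · rintro ⟨hbj, hje, hlt⟩
      rcases hje.lt_or_eq with h | h
      · exact .inr ⟨j - 1, ⟨by lia, by simpa using hlt h⟩, by ring⟩
      · exact .inl h
end

section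
/- Let p be a polynomial with real coefficients of degree at least 2, let A = {p(n) : n ∈ ℤ} ⊆ ℝ, and let d ≥ 2 be an integer. Then no natural number is a Helly bound for A^d ⊆ ℝ^d: for every N ∈ ℕ there exists a finite family F of convex sets in ℝ^d such that the intersection of every subfamily of at most N members of F contains a point of A^d, but the intersection of all members of F contains no point of A^d. (In other words, H(A^d) = ∞.) -/
open Filter Topology Polynomial

/-- Two sequences of `K + 1` points of `A` such that every point of `A × A` is strictly separated
from the points of the planar sequence by a line, after omitting at most one of them. -/
def SeparableTuples (A : Set ℝ) (K : ℕ) : Prop :=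
  ∃ x y : ℕ → ℝ, (∀ j ≤ K, x j ∈ A ∧ y j ∈ A) ∧
    ∀ t ∈ A, ∀ u ∈ A, ∃ k : ℕ, ∃ α β : ℝ, ∀ j ≤ K, j ≠ k → α * t + β * u < α * x j + β * y j

theorem SeparableTuples.not_hellyBound {A : Set ℝ} {N d : ℕ} (h : SeparableTuples A N)
    (hd : 2 ≤ d) : ¬ HellyBound d {z : Fin d → ℝ | ∀ i, z i ∈ A} N := by
  classical
  obtain ⟨x, y, hA, hsep⟩ := h
  intro H
  let i₀ : Fin d := ⟨0, by omega⟩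
  let i₁ : Fin d := ⟨1, by omega⟩
  have hi : i₀ ≠ i₁ := by simp [i₀, i₁]
  let v : ℕ → Fin d → ℝ := fun j i => if i = i₁ then y j else x j
  have hv₀ : ∀ j, v j i₀ = x j := fun j => by simp [v, hi]
  have hv₁ : ∀ j, v j i₁ = y j := fun j => by simp [v]
  let C : ℕ → Set (Fin d → ℝ) := fun k => convexHull ℝ (v '' {j | j ≤ N ∧ j ≠ k})
  obtain ⟨z, hzA, hz⟩ := H ((Finset.range (N + 1)).image C)
    (by
      intro B hB
      obtain ⟨k, -, rfl⟩ := Finset.mem_image.1 hB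
      exact convex_convexHull ℝ _)
    (by
      intro G hG hcard
      have hidx : ∀ B ∈ G, ∃ k, C k = B := fun B hB => by
        obtain ⟨k, -, hk⟩ := Finset.mem_image.1 (hG hB)
        exact ⟨k, hk⟩
      choose! r hr using hidx
      obtain ⟨j, hj, hjr⟩ : ∃ j ∈ Finset.range (N + 1), j ∉ G.image r := by
        apply Finset.exists_mem_notMem_of_card_lt_card
        have := Finset.card_image_le (s := G) (f := r)
        simp only [Finset.card_range]
        omega
      have hjN : j ≤ N := by simpa [Nat.lt_succ_iff] using hj
      refine ⟨v j, fun i => ?_, fun B hB => ?_⟩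
      · by_cases h1 : i = i₁ <;> simp [v, h1, hA j hjN]
      · rw [← hr B hB]
        refine subset_convexHull ℝ _ ⟨j, ⟨hjN, ?_⟩, rfl⟩
        rintro rfl
        exact hjr (Finset.mem_image_of_mem r hB))
  obtain ⟨k, α, β, hk⟩ := hsep (z i₀) (hzA i₀) (z i₁) (hzA i₁)
  obtain ⟨k', hk'N, hk'⟩ : ∃ k' ≤ N, ∀ j ≤ N, j ≠ k' → j ≠ k := by
    by_cases hkN : k ≤ N
    · exact ⟨k, hkN, fun j _ h => h⟩
    · exact ⟨0, by omega, fun j hj _ => by omega⟩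
  have hmem : z ∈ C k' := hz _ (Finset.mem_image_of_mem C (by simp; omega))
  have hconv : Convex ℝ {w : Fin d → ℝ | α * z i₀ + β * z i₁ < α * w i₀ + β * w i₁} := by
    refine convex_halfSpace_gt (f := fun w : Fin d → ℝ => α * w i₀ + β * w i₁) ⟨?_, ?_⟩ _
    · intro a b
      simp only [Pi.add_apply]
      ring
    · intro c a
      simp only [Pi.smul_apply, smul_eq_mul]
      ring
  have hsub : C k' ⊆ {w : Fin d → ℝ | α * z i₀ + β * z i₁ < α * w i₀ + β * w i₁} := by
    refine convexHull_min ?_ hconv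
    rintro _ ⟨j, ⟨hjN, hjk⟩, rfl⟩
    simpa [hv₀, hv₁] using hk j hjN (hk' j hjN hjk)
  have hlt : α * z i₀ + β * z i₁ < α * z i₀ + β * z i₁ := hsub hmem
  exact lt_irrefl _ hlt

theorem SeparableTuples.of_neg {A : Set ℝ} {K : ℕ} (h : SeparableTuples (-A) K) :
    SeparableTuples A K := by
  obtain ⟨x, y, hA, hsep⟩ := h
  refine ⟨fun j => -x j, fun j => -y j, fun j hj => by simpa using hA j hj, fun t ht u hu => ?_⟩
  obtain ⟨k, α, β, hk⟩ := hsep (-t) (by simpa using ht) (-u) (by simpa using hu)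
  exact ⟨k, -α, -β, fun j hj hjk => by linarith [hk j hj hjk]⟩

/-- On `[X₀, ∞)` the function `f` lies strictly above its tangents of positive slope `f'`, and
its increments are asymptotically linear when measured in units of `f'`. -/
structure RegularTail (f f' : ℝ → ℝ) (X₀ : ℝ) : Prop where
  pos : ∀ x, X₀ ≤ x → 0 < f' x
  tangent : ∀ x y, X₀ ≤ x → X₀ ≤ y → x ≠ y → f x + f' x * (y - x) < f y
  shift : ∀ c : ℝ, Tendsto (fun x => (f (x + c) - f x) / f' x) atTop (𝓝 c)

theorem RegularTail.strictMonoOn {f f' : ℝ → ℝ} {X₀ : ℝ} (h : RegularTail f f' X₀) :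
    StrictMonoOn f (Set.Ici X₀) := by
  intro x hx y hy hxy
  have h1 := h.tangent x y hx hy hxy.ne
  have h2 := mul_pos (h.pos x hx) (sub_pos.2 hxy)
  linarith

/-- If two positions `a`, `b` add up to `K`, then the tangent line at `f (x + a), f (x + b)` to the
curve `τ ↦ (f (x + τ), f (x + (K - τ)))` separates; otherwise a line of slope `-1` does. -/
theorem RegularTail.eventually_separated {f f' φ ψ : ℝ → ℝ} {X₀ a b : ℝ} (h : RegularTail f f' X₀)
    (K : ℕ) (hφ : Tendsto (fun x => (φ x - f x) / f' x) atTop (𝓝 a))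
    (hψ : Tendsto (fun x => (ψ x - f x) / f' x) atTop (𝓝 b))
    (hφf : ∀ᶠ x in atTop, φ x ≤ f (x + a)) (hψf : ∀ᶠ x in atTop, ψ x ≤ f (x + b)) :
    ∀ᶠ x in atTop, ∃ k : ℕ, ∃ α β : ℝ, ∀ j : ℕ, j ≤ K → j ≠ k →
      α * φ x + β * ψ x < α * f (x + j) + β * f (x + (K - j)) := by
  have hsum : ∀ j : ℕ, Tendsto (fun x => (f (x + j) - f x) / f' x + (f (x + (K - j)) - f x) / f' x)
      atTop (𝓝 K) := fun j => by
    simpa using (h.shift j).add (h.shift (K - j))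
  have hpos : ∀ᶠ x in atTop, 0 < f' x := by
    filter_upwards [eventually_ge_atTop X₀] with x hx using h.pos x hx
  rcases lt_trichotomy (a + b) K with hab | hab | hab
  · have key : ∀ᶠ x in atTop, ∀ j ∈ Finset.range (K + 1), (φ x - f x) / f' x + (ψ x - f x) / f' x <
        (f (x + j) - f x) / f' x + (f (x + (K - j)) - f x) / f' x :=
      (eventually_all_finset _).2 fun j _ => (hφ.add hψ).eventually_lt (hsum j) hab
    filter_upwards [key, hpos] with x hx hx'
    refine ⟨0, 1, 1, fun j hj _ => ?_⟩
    have := hx j (by simp; omega)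
    rw [← add_div, ← add_div, div_lt_div_iff_of_pos_right hx'] at this
    linarith
  · have hX : ∀ r : ℝ, ∀ᶠ x in atTop, X₀ ≤ x + r :=
      fun r => (tendsto_atTop_add_const_right _ r tendsto_id).eventually_ge_atTop X₀
    filter_upwards [hφf, hψf, hX a, hX b, hX 0] with x h1 h2 h3 h4 h5
    refine ⟨⌊a⌋₊, f' (x + b), f' (x + a), fun j hj hjk => ?_⟩
    have hja : (j : ℝ) ≠ a := by
      rintro rfl
      simp at hjk
    have hjK : (j : ℝ) ≤ K := by exact_mod_cast hj
    have hj0 : (0 : ℝ) ≤ j := j.cast_nonneg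
    have t1 := h.tangent (x + a) (x + j) h3 (by linarith) (fun e => hja (by linarith))
    have t2 := h.tangent (x + b) (x + (K - j)) h4 (by linarith) (fun e => hja (by linarith))
    have p1 := h.pos _ h3
    have p2 := h.pos _ h4
    have e : (x + (K - j) - (x + b) : ℝ) = -(x + j - (x + a)) := by linarith
    rw [e] at t2
    have m1 := mul_lt_mul_of_pos_left t1 p2
    have m2 := mul_lt_mul_of_pos_left t2 p1
    have m3 := mul_le_mul_of_nonneg_left h1 p2.le
    have m4 := mul_le_mul_of_nonneg_left h2 p1.le
    linarith
  · have key : ∀ᶠ x in atTop, ∀ j ∈ Finset.range (K + 1),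
        (f (x + j) - f x) / f' x + (f (x + (K - j)) - f x) / f' x <
          (φ x - f x) / f' x + (ψ x - f x) / f' x :=
      (eventually_all_finset _).2 fun j _ => (hsum j).eventually_lt (hφ.add hψ) hab
    filter_upwards [key, hpos] with x hx hx'
    refine ⟨0, -1, -1, fun j hj _ => ?_⟩
    have := hx j (by simp; omega)
    rw [← add_div, ← add_div, div_lt_div_iff_of_pos_right hx'] at this
    linarith

theorem RegularTail.separableTuples {A : Set ℝ} {f f' g : ℝ → ℝ} {X₀ s : ℝ}
    (h : RegularTail f f' X₀) (hf : Tendsto f atTop atTop) (hg : MonotoneOn g (Set.Ici X₀))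
    (hgs : ∀ c : ℝ, Tendsto (fun x => (g (x + c) - f x) / f' x) atTop (𝓝 (c + s)))
    (hgf : ∀ᶠ x in atTop, g x ≤ f (x + s)) (hfA : ∀ m : ℤ, X₀ ≤ m → f m ∈ A) {T : ℝ}
    (hA : ∀ t ∈ A, T < t → ∃ m : ℤ, X₀ ≤ m ∧ (t = f m ∨ t = g m)) (K : ℕ) :
    SeparableTuples A K := by
  obtain ⟨M, hM⟩ := exists_nat_ge (|s| + K + 1)
  have hs := abs_le.1 (le_refl |s|)
  have hshift : ∀ r : ℝ, Tendsto (fun x : ℝ => x + r) atTop atTop :=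
    fun r => tendsto_atTop_add_const_right _ r tendsto_id
  let φ : Bool → ℤ → ℝ → ℝ := fun b i x => bif b then f (x + i) else g (x + i)
  let τ : Bool → ℤ → ℝ := fun b i => bif b then i else i + s
  have hφ : ∀ b i, Tendsto (fun x => (φ b i x - f x) / f' x) atTop (𝓝 (τ b i)) := by
    rintro (_ | _) i
    · exact hgs i
    · exact h.shift i
  have hφf : ∀ b i, ∀ᶠ x in atTop, φ b i x ≤ f (x + τ b i) := by
    rintro (_ | _) i
    · filter_upwards [(hshift i).eventually hgf] with x hx
      simpa [φ, τ, add_assoc] using hx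
    · exact Eventually.of_forall fun x => le_rfl
  have hpairs : ∀ᶠ x in atTop, ∀ b b' : Bool, ∀ i ∈ Finset.Icc (-M : ℤ) M,
      ∀ i' ∈ Finset.Icc (-M : ℤ) M, ∃ k : ℕ, ∃ α β : ℝ, ∀ j : ℕ, j ≤ K → j ≠ k →
        α * φ b i x + β * φ b' i' x < α * f (x + j) + β * f (x + (K - j)) := by
    simp only [eventually_all, eventually_all_finset]
    exact fun b b' i _ i' _ =>
      h.eventually_separated K (hφ b i) (hφ b' i') (hφf b i) (hφf b' i')
  have hlow : ∀ᶠ x in atTop, g (x + -M) < f x := by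
    filter_upwards [(hgs (-M)).eventually_lt_const (show (-M + s : ℝ) < 0 by
      linarith [(K.cast_nonneg : (0 : ℝ) ≤ K)]), eventually_ge_atTop X₀] with x hx hx'
    rw [div_lt_iff₀ (h.pos x hx')] at hx
    linarith
  have hhigh : ∀ᶠ x in atTop, f (x + K) < g (x + M) := by
    filter_upwards [(h.shift K).eventually_lt (hgs M) (by linarith), eventually_ge_atTop X₀]
      with x hx hx'
    rw [div_lt_div_iff_of_pos_right (h.pos x hx')] at hx
    linarith
  obtain ⟨n, hpn, hln, hhn, hTn, hXn⟩ := (tendsto_natCast_atTop_atTop.eventually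
    (hpairs.and (hlow.and (hhigh.and ((hf.eventually_gt_atTop T).and
      ((hshift (-M)).eventually_ge_atTop X₀)))))).exists
  have hM0 : (0 : ℝ) ≤ M := M.cast_nonneg
  have hfm : ∀ {x y : ℝ}, X₀ ≤ x → x ≤ y → f x ≤ f y := fun hx hxy =>
    h.strictMonoOn.monotoneOn hx (hx.trans hxy) hxy
  have hcover : ∀ t ∈ A, (∀ r : ℝ, 0 ≤ r → r ≤ K → t < f (n + r)) ∨
      (∀ r : ℝ, 0 ≤ r → r ≤ K → f (n + r) < t) ∨
      ∃ b, ∃ i ∈ Finset.Icc (-M : ℤ) M, t = φ b i n := by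
    intro t ht
    rcases le_or_gt t T with htT | htT
    · exact Or.inl fun r hr _ => (htT.trans_lt hTn).trans_le (hfm (by linarith) (by linarith))
    obtain ⟨m, hm, hmt⟩ := hA t ht htT
    rcases lt_or_ge m (n - M) with h1 | h1
    · have h1' : (m : ℝ) < n + -M := by
        have : (m : ℝ) < ((n - M : ℤ) : ℝ) := by exact_mod_cast h1
        push_cast at this
        linarith
      refine Or.inl fun r hr _ => ?_
      have h2 : f n ≤ f (n + r) := hfm (by linarith) (by linarith)
      rcases hmt with rfl | rfl
      · exact h.strictMonoOn hm (show X₀ ≤ n + r by linarith) (by linarith)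
      · exact ((hg hm hXn h1'.le).trans_lt hln).trans_le h2
    rcases lt_or_ge (n + M : ℤ) m with h2 | h2
    · have h2' : (n + M : ℝ) < m := by exact_mod_cast h2
      refine Or.inr (Or.inl fun r hr hrK => ?_)
      have hsn := abs_nonneg s
      rcases hmt with rfl | rfl
      · exact h.strictMonoOn (show X₀ ≤ n + r by linarith) hm (by linarith)
      · have h3 : f (n + r) ≤ f (n + K) := hfm (by linarith) (by linarith)
        exact (h3.trans_lt hhn).trans_le (hg (show X₀ ≤ n + M by linarith) hm h2'.le)
    · refine Or.inr (Or.inr ?_)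
      have hi : m - n ∈ Finset.Icc (-M : ℤ) M := by
        rw [Finset.mem_Icc]
        omega
      rcases hmt with rfl | rfl
      · exact ⟨true, m - n, hi, by simp [φ]⟩
      · exact ⟨false, m - n, hi, by simp [φ]⟩
  have hr : ∀ j : ℕ, j ≤ K → (0 : ℝ) ≤ j ∧ (j : ℝ) ≤ K := fun j hj =>
    ⟨j.cast_nonneg, by exact_mod_cast hj⟩
  have hr' : ∀ j : ℕ, j ≤ K → (0 : ℝ) ≤ K - j ∧ (K - j : ℝ) ≤ K := fun j hj =>
    ⟨by linarith [(hr j hj).2], by linarith [(hr j hj).1]⟩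
  refine ⟨fun j => f (n + j), fun j => f (n + (K - j)), fun j hj => ⟨?_, ?_⟩, fun t ht u hu => ?_⟩
  · have := hfA (n + j) (by push_cast; linarith [(hr j hj).1])
    push_cast at this
    exact this
  · have := hfA (n + (K - j)) (by push_cast; linarith [(hr' j hj).1])
    push_cast at this
    exact this
  rcases hcover t ht with h1 | h1 | ⟨b, i, hi, rfl⟩
  · exact ⟨0, 1, 0, fun j hj _ => by linarith [h1 j (hr j hj).1 (hr j hj).2]⟩
  · exact ⟨0, -1, 0, fun j hj _ => by linarith [h1 j (hr j hj).1 (hr j hj).2]⟩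
  rcases hcover u hu with h2 | h2 | ⟨b', i', hi', rfl⟩
  · exact ⟨0, 0, 1, fun j hj _ => by linarith [h2 _ (hr' j hj).1 (hr' j hj).2]⟩
  · exact ⟨0, 0, -1, fun j hj _ => by linarith [h2 _ (hr' j hj).1 (hr' j hj).2]⟩
  exact hpn b b' i hi i' hi'

theorem eventually_eval_pos {P : ℝ[X]} (hP : 0 < P.leadingCoeff) :
    ∀ᶠ x in atTop, 0 < P.eval x := by
  rcases Nat.eq_zero_or_pos P.natDegree with h0 | h0
  · obtain ⟨c, rfl⟩ := natDegree_eq_zero.1 h0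
    exact Eventually.of_forall fun x => by simpa using hP
  · exact (P.tendsto_atTop_of_leadingCoeff_nonneg (natDegree_pos_iff_degree_pos.1 h0)
      hP.le).eventually_gt_atTop 0

theorem eventually_eval_nonneg_or_nonpos (P : ℝ[X]) :
    (∀ᶠ x in atTop, 0 ≤ P.eval x) ∨ ∀ᶠ x in atTop, P.eval x ≤ 0 := by
  rcases lt_trichotomy P.leadingCoeff 0 with h | h | h
  · right
    filter_upwards [eventually_eval_pos (P := -P) (by simpa using h)] with x hx
    simp only [eval_neg] at hx
    linarith
  · simp [leadingCoeff_eq_zero.1 h]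
  · exact Or.inl ((eventually_eval_pos h).mono fun _ => le_of_lt)

theorem tendsto_eval_add_div_eval {P : ℝ[X]} (hP : P ≠ 0) (c : ℝ) :
    Tendsto (fun x => P.eval (x + c) / P.eval x) atTop (𝓝 1) := by
  have := div_tendsto_atTop_leadingCoeff_div_of_degree_eq (taylor c P) P (degree_taylor P c)
  simpa [taylor_eval, leadingCoeff_taylor, div_self (leadingCoeff_ne_zero.2 hP)] using this

theorem leadingCoeff_derivative_pos {P : ℝ[X]} (hP : 0 < P.leadingCoeff) (hd : 1 ≤ P.natDegree) :
    0 < (derivative P).leadingCoeff := by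
  rw [leadingCoeff_derivative]
  have : (0 : ℝ) < P.natDegree := by exact_mod_cast hd
  positivity

theorem eventually_regularTail {P : ℝ[X]} (hP : 0 < P.leadingCoeff) (hd : 2 ≤ P.natDegree) :
    ∀ᶠ X₀ in atTop, RegularTail (fun x => P.eval x) (fun x => (derivative P).eval x) X₀ := by
  have hP' := leadingCoeff_derivative_pos hP (by omega)
  have hP'' := leadingCoeff_derivative_pos hP' (by rw [natDegree_derivative]; omega)
  have h1 := eventually_eval_pos hP'
  have h2 := eventually_eval_pos hP''
  obtain ⟨X₁, hX₁⟩ := eventually_atTop.1 (h1.and h2)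
  have hpos : ∀ x, X₁ ≤ x → 0 < (derivative P).eval x := fun x hx => (hX₁ x hx).1
  have hmono : StrictMonoOn (fun x => (derivative P).eval x) (Set.Ici X₁) := by
    refine strictMonoOn_of_deriv_pos (convex_Ici _) (derivative P).continuous.continuousOn ?_
    intro x hx
    rw [interior_Ici] at hx
    rw [Polynomial.deriv]
    exact (hX₁ x (le_of_lt hx)).2
  have htan : ∀ x y, X₁ ≤ x → X₁ ≤ y → x ≠ y →
      P.eval x + (derivative P).eval x * (y - x) < P.eval y := by
    intro x y hx hy hxy
    rcases lt_or_gt_of_ne hxy with h | h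
    · obtain ⟨c, hc, hc'⟩ := exists_hasDerivAt_eq_slope (fun x => P.eval x) _ h
        P.continuous.continuousOn fun z _ => P.hasDerivAt z
      have := hmono hx (hx.trans hc.1.le) hc.1
      simp only [hc', lt_div_iff₀ (sub_pos.2 h)] at this
      linarith
    · obtain ⟨c, hc, hc'⟩ := exists_hasDerivAt_eq_slope (fun x => P.eval x) _ h
        P.continuous.continuousOn fun z _ => P.hasDerivAt z
      have := hmono (hy.trans hc.1.le) hx hc.2
      simp only [hc', div_lt_iff₀ (sub_pos.2 h)] at this
      linarith
  have htan' : ∀ x y, X₁ ≤ x → X₁ ≤ y →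
      P.eval x + (derivative P).eval x * (y - x) ≤ P.eval y := by
    intro x y hx hy
    rcases eq_or_ne x y with rfl | hxy
    · simp
    · exact (htan x y hx hy hxy).le
  have hshift : ∀ c : ℝ, Tendsto (fun x => (P.eval (x + c) - P.eval x) / (derivative P).eval x)
      atTop (𝓝 c) := by
    intro c
    have hP'0 : derivative P ≠ 0 := leadingCoeff_ne_zero.1 hP'.ne'
    have hup := (tendsto_eval_add_div_eval hP'0 c).mul_const c
    rw [one_mul] at hup
    have hXc : ∀ᶠ x in atTop, X₁ ≤ x + c :=
      (tendsto_atTop_add_const_right _ c tendsto_id).eventually_ge_atTop X₁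
    refine tendsto_of_tendsto_of_tendsto_of_le_of_le' tendsto_const_nhds hup ?_ ?_
    · filter_upwards [eventually_ge_atTop X₁, hXc] with x hx hxc
      rw [le_div_iff₀ (hpos x hx)]
      linarith [htan' x (x + c) hx hxc]
    · filter_upwards [eventually_ge_atTop X₁, hXc] with x hx hxc
      rw [div_mul_eq_mul_div, div_le_div_iff_of_pos_right (hpos x hx)]
      linarith [htan' (x + c) x hxc hx]
  filter_upwards [eventually_ge_atTop X₁] with X₀ hX₀
  exact ⟨fun x hx => hpos x (hX₀.trans hx),
    fun x y hx hy => htan x y (hX₀.trans hx) (hX₀.trans hy), hshift⟩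

theorem exists_tendsto_sub_div_derivative {P Q : ℝ[X]} (hd : 2 ≤ P.natDegree)
    (hdeg : Q.natDegree = P.natDegree) (hlead : Q.leadingCoeff = P.leadingCoeff) :
    ∃ s, Tendsto (fun x => (Q.eval x - P.eval x) / (derivative P).eval x) atTop (𝓝 s) := by
  have hQ0 : Q ≠ 0 := by
    rintro rfl
    simp at hdeg
    omega
  have hP0 : P ≠ 0 := by
    rintro rfl
    simp at hd
  have hlt : (Q - P).degree < Q.degree :=
    degree_sub_lt_left (by rw [degree_eq_natDegree hQ0, degree_eq_natDegree hP0, hdeg]) hQ0 hlead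
  have hle : (Q - P).degree ≤ (derivative P).degree := by
    rw [degree_derivative (by omega)]
    rw [degree_eq_natDegree hQ0, hdeg] at hlt
    rcases eq_or_ne (Q - P) 0 with h0 | h0
    · simp [h0]
    · rw [degree_eq_natDegree h0] at hlt ⊢
      have : (Q - P).natDegree < P.natDegree := by exact_mod_cast hlt
      exact_mod_cast (by omega : (Q - P).natDegree ≤ P.natDegree - 1)
  simp only [← eval_sub]
  rcases hle.lt_or_eq with h | h
  · exact ⟨0, div_tendsto_atTop_zero_of_degree_lt _ _ h⟩
  · exact ⟨_, div_tendsto_atTop_leadingCoeff_div_of_degree_eq _ _ h⟩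

theorem separableTuples_of_le {A : Set ℝ} {P Q : ℝ[X]} {s : ℝ} (hP : 0 < P.leadingCoeff)
    (hd : 2 ≤ P.natDegree) (hdeg : Q.natDegree = P.natDegree)
    (hlead : Q.leadingCoeff = P.leadingCoeff)
    (hs : Tendsto (fun x => (Q.eval x - P.eval x) / (derivative P).eval x) atTop (𝓝 s))
    (hQP : ∀ᶠ x in atTop, Q.eval x ≤ P.eval (x + s)) (hPA : ∀ m : ℤ, P.eval (m : ℝ) ∈ A)
    (hA : ∀ X : ℝ, ∃ T : ℝ, ∀ t ∈ A, T < t →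
      ∃ m : ℤ, X ≤ m ∧ (t = P.eval (m : ℝ) ∨ t = Q.eval (m : ℝ))) (K : ℕ) :
    SeparableTuples A K := by
  obtain ⟨X₀, h, hQ⟩ := ((eventually_regularTail hP hd).and
    (eventually_regularTail (P := Q) (by rwa [hlead]) (by rwa [hdeg]))).exists
  obtain ⟨T, hT⟩ := hA X₀
  have hP'0 : derivative P ≠ 0 :=
    leadingCoeff_ne_zero.1 (leadingCoeff_derivative_pos hP (by omega)).ne'
  refine h.separableTuples (P.tendsto_atTop_of_leadingCoeff_nonneg
    (natDegree_pos_iff_degree_pos.1 (by omega)) hP.le) hQ.strictMonoOn.monotoneOn (s := s) ?_ hQP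
    (fun m _ => hPA m) hT K
  intro c
  have hc : Tendsto (fun x : ℝ => x + c) atTop atTop :=
    tendsto_atTop_add_const_right _ c tendsto_id
  have hlim := (h.shift c).add ((hs.comp hc).mul (tendsto_eval_add_div_eval hP'0 c))
  rw [mul_one] at hlim
  refine hlim.congr' ?_
  filter_upwards [eventually_ge_atTop X₀, hc.eventually_ge_atTop X₀] with x hx hxc
  have h1 := (h.pos x hx).ne'
  have h2 := (h.pos _ hxc).ne'
  simp only [Function.comp_apply]
  field_simp
  ring

theorem separableTuples_of_two_tails {A : Set ℝ} {P Q : ℝ[X]} (hP : 0 < P.leadingCoeff)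
    (hd : 2 ≤ P.natDegree) (hdeg : Q.natDegree = P.natDegree)
    (hlead : Q.leadingCoeff = P.leadingCoeff) (hPA : ∀ m : ℤ, P.eval (m : ℝ) ∈ A)
    (hQA : ∀ m : ℤ, Q.eval (m : ℝ) ∈ A)
    (hA : ∀ X : ℝ, ∃ T : ℝ, ∀ t ∈ A, T < t →
      ∃ m : ℤ, X ≤ m ∧ (t = P.eval (m : ℝ) ∨ t = Q.eval (m : ℝ))) (K : ℕ) :
    SeparableTuples A K := by
  obtain ⟨s, hs⟩ := exists_tendsto_sub_div_derivative hd hdeg hlead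
  rcases eventually_eval_nonneg_or_nonpos (taylor s P - Q) with hsign | hsign
  · refine separableTuples_of_le hP hd hdeg hlead hs ?_ hPA hA K
    filter_upwards [hsign] with x hx
    simpa [taylor_eval] using hx
  · have hQ : 0 < Q.leadingCoeff := by rwa [hlead]
    have hP' := leadingCoeff_derivative_pos hP (by omega)
    have hQ' := leadingCoeff_derivative_pos hQ (by omega)
    have hratio : Tendsto (fun x => (derivative P).eval x / (derivative Q).eval x) atTop (𝓝 1) := by
      have := div_tendsto_atTop_leadingCoeff_div_of_degree_eq (derivative P) (derivative Q) (by
        rw [degree_derivative (by omega), degree_derivative (by omega), hdeg])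
      rwa [leadingCoeff_derivative, leadingCoeff_derivative, hlead, hdeg,
        ← leadingCoeff_derivative, div_self hP'.ne'] at this
    have hs' : Tendsto (fun x => (P.eval x - Q.eval x) / (derivative Q).eval x) atTop
        (𝓝 (-s)) := by
      have hlim := hs.neg.mul hratio
      rw [mul_one] at hlim
      refine hlim.congr' ?_
      filter_upwards [eventually_eval_pos hP', eventually_eval_pos hQ'] with x h1 h2
      field_simp
      ring
    refine separableTuples_of_le hQ (by omega) hdeg.symm hlead.symm hs' ?_ hQA
      (fun X => (hA X).imp fun T hT t ht htT => (hT t ht htT).imp fun m hm => ⟨hm.1, hm.2.symm⟩) K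
    filter_upwards [(tendsto_atTop_add_const_right _ (-s) tendsto_id).eventually hsign] with x hx
    simpa [taylor_eval] using hx

theorem separableTuples_range_eval {p : ℝ[X]} (hp : 2 ≤ p.natDegree) (hlead : 0 < p.leadingCoeff)
    (K : ℕ) : SeparableTuples {a | ∃ n : ℤ, a = p.eval (n : ℝ)} K := by
  have hcomp : (p.comp (-X)).natDegree = p.natDegree := by simp [natDegree_comp]
  have hbdd : ∀ X : ℝ, ∃ T : ℝ, ∀ x ∈ Set.Icc (-X) X, p.eval x ≤ T := fun X =>
    (isCompact_Icc.bddAbove_image p.continuous.continuousOn).imp fun T hT x hx =>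
      hT (Set.mem_image_of_mem _ hx)
  rcases p.natDegree.even_or_odd with hpar | hpar
  · refine separableTuples_of_two_tails (A := {a | ∃ n : ℤ, a = p.eval (n : ℝ)})
      (Q := p.comp (-X)) hlead hp hcomp (by rw [comp_neg_X_leadingCoeff_eq, hpar.neg_one_pow, one_mul])
      (fun m => ⟨m, rfl⟩) (fun m => ⟨-m, by simp⟩) (fun X => ?_) K
    obtain ⟨T, hT⟩ := hbdd X
    refine ⟨T, ?_⟩
    rintro _ ⟨m, rfl⟩ hm
    by_cases h1 : X ≤ m
    · exact ⟨m, h1, Or.inl rfl⟩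
    · refine ⟨-m, ?_, Or.inr (by simp)⟩
      by_contra! h2
      push_cast at h2
      exact absurd (hT m ⟨by linarith, by linarith⟩) (not_le.2 hm)
  · refine separableTuples_of_two_tails (A := {a | ∃ n : ℤ, a = p.eval (n : ℝ)})
      (Q := p) hlead hp rfl rfl (fun m => ⟨m, rfl⟩) (fun m => ⟨m, rfl⟩) (fun X => ?_) K
    have hneg : ∀ᶠ x in atTop, 0 < (-p.comp (-Polynomial.X)).eval x := by
      refine eventually_eval_pos ?_
      rw [leadingCoeff_neg, comp_neg_X_leadingCoeff_eq, hpar.neg_one_pow]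
      simpa using hlead
    obtain ⟨Y, hY⟩ := eventually_atTop.1 hneg
    obtain ⟨T, hT⟩ := hbdd (max X Y)
    refine ⟨max T 0, ?_⟩
    rintro _ ⟨m, rfl⟩ hm
    refine ⟨m, ?_, Or.inl rfl⟩
    by_contra! h1
    have hX := le_max_left X Y
    rcases le_total (-max X Y) m with h2 | h2
    · exact absurd (hT m ⟨h2, by linarith⟩) (not_le.2 ((le_max_left _ _).trans_lt hm))
    · have h3 := hY (-m) (by linarith [le_max_right X Y])
      simp only [eval_neg, eval_comp, eval_X, neg_neg] at h3
      linarith [(le_max_right T 0).trans_lt hm]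

/-- If `p` is a real polynomial of degree at least `2` and `A = {p(n) : n ∈ ℤ}`, then
`H(A^d) = ∞` for every `d ≥ 2`: no natural number is a Helly bound for `A^d ⊆ ℝ^d`. -/
theorem polynomial_image_infinite_helly (p : Polynomial ℝ) (hp : 2 ≤ p.natDegree)
    (d : ℕ) (hd : 2 ≤ d) (N : ℕ) :
    ¬ HellyBound d {z : Fin d → ℝ | ∀ i, ∃ n : ℤ, z i = p.eval (n : ℝ)} N := by
  refine SeparableTuples.not_hellyBound (A := {a | ∃ n : ℤ, a = p.eval (n : ℝ)}) ?_ hd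
  have hp0 : p.leadingCoeff ≠ 0 := leadingCoeff_ne_zero.2 (by rintro rfl; simp at hp)
  rcases lt_or_gt_of_ne hp0 with h | h
  · refine SeparableTuples.of_neg ?_
    convert separableTuples_range_eval (p := -p) (by simpa using hp) (by simpa using h) N using 1
    ext a
    simp [neg_eq_iff_eq_neg]
  · exact separableTuples_range_eval hp h N
end
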